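/- ∑_{n=2}^∞ (H_{n−1}/n³)·(4^{−n}·binom(2n,n))^{−2} = 32C² − 32πC·log 2 − 64π·Im(Li₃((1+i)/2)) + 3π⁴/2 + 2π²·log²2, where H_{n−1} = ∑_{k=1}^{n−1} 1/k is the ordinary harmonic number. -/

import Mathlib

/-- Catalan's constant `C = ∑_{k≥0} (-1)^k/(2k+1)²`. -/
noncomputable def catalanConst : ℝ := ∑' k : ℕ, (-1 : ℝ) ^ k / ((2 * k + 1 : ℕ) : ℝ) ^ 2

/-- `β(4) = ∑_{k≥0} (-1)^k/(2k+1)⁴`. -/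
noncomputable def diriBeta4 : ℝ := ∑' k : ℕ, (-1 : ℝ) ^ k / ((2 * k + 1 : ℕ) : ℝ) ^ 4

/-- The real polylogarithm `Li_s(x) = ∑_{n≥1} xⁿ/n^s`. -/
noncomputable def rpolylog (s : ℕ) (x : ℝ) : ℝ :=
  ∑' n : ℕ, x ^ (n + 1) / ((n + 1 : ℕ) : ℝ) ^ s

/-- The complex polylogarithm `Li_s(z) = ∑_{n≥1} zⁿ/n^s`. -/
noncomputable def cpolylog (s : ℕ) (z : ℂ) : ℂ :=
  ∑' n : ℕ, z ^ (n + 1) / ((n + 1 : ℕ) : ℂ) ^ s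

/-! ### Complex polylogarithms inside the unit disc -/

section

open Real Set Filter Topology MeasureTheory intervalIntegral

/-- The normalised polylogarithm `Li_s(z) / z`. -/
noncomputable def polylogQuot (s : ℕ) (z : ℂ) : ℂ :=
  ∑' n : ℕ, z ^ n / ((n + 1 : ℕ) : ℂ) ^ s

lemma cpolylog_eq_mul_polylogQuot (s : ℕ) (z : ℂ) : cpolylog s z = z * polylogQuot s z := by
  rw [cpolylog, polylogQuot, ← tsum_mul_left]
  exact tsum_congr fun n => by ring

lemma norm_pow_div_le {r : ℝ} {y : ℂ} (hy : ‖y‖ ≤ r) (s n : ℕ) :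
    ‖y ^ n / ((n + 1 : ℕ) : ℂ) ^ s‖ ≤ r ^ n := by
  rw [norm_div, norm_pow, norm_pow, Complex.norm_natCast]
  have h1 : (1 : ℝ) ≤ ((n + 1 : ℕ) : ℝ) ^ s :=
    one_le_pow₀ (by push_cast; linarith [n.cast_nonneg (α := ℝ)])
  calc ‖y‖ ^ n / ((n + 1 : ℕ) : ℝ) ^ s ≤ ‖y‖ ^ n := div_le_self (by positivity) h1
    _ ≤ r ^ n := by gcongr

lemma continuousOn_polylogQuot (s : ℕ) {r : ℝ} (hr0 : 0 ≤ r) (hr : r < 1) :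
    ContinuousOn (polylogQuot s) (Metric.closedBall 0 r) := by
  refine continuousOn_tsum (u := fun n => r ^ n) (fun n => by fun_prop)
    (summable_geometric_of_lt_one hr0 hr) fun n y hy => norm_pow_div_le (by simpa using hy) s n

lemma hasDerivAt_cpolylog_succ (s : ℕ) {z : ℂ} (hz : ‖z‖ < 1) :
    HasDerivAt (cpolylog (s + 1)) (polylogQuot s z) z := by
  obtain ⟨r, hr, hr1⟩ := exists_between hz
  have hr0 : 0 ≤ r := (norm_nonneg z).trans hr.le
  refine hasDerivAt_tsum_of_isPreconnected (u := fun n => r ^ n) (t := Metric.ball 0 r) (y₀ := 0)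
    (g := fun n z => z ^ (n + 1) / ((n + 1 : ℕ) : ℂ) ^ (s + 1))
    (g' := fun n z => z ^ n / ((n + 1 : ℕ) : ℂ) ^ s)
    (summable_geometric_of_lt_one hr0 hr1) Metric.isOpen_ball
    (convex_ball _ _).isPreconnected (fun n y _ => ?_) (fun n y hy => ?_) ?_ ?_ ?_
  · have := (hasDerivAt_pow (n + 1) y).div_const (((n + 1 : ℕ) : ℂ) ^ (s + 1))
    refine this.congr_deriv ?_
    have : ((n + 1 : ℕ) : ℂ) ≠ 0 := by exact_mod_cast n.succ_ne_zero
    simp only [Nat.add_sub_cancel]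
    field_simp
    ring
  · exact norm_pow_div_le (by simpa using (Metric.mem_ball.1 hy).le) s n
  · simpa using (norm_nonneg z).trans_lt hr
  · simp
  · simpa using hr

lemma cpolylog_one {z : ℂ} (hz : ‖z‖ < 1) : cpolylog 1 z = -Complex.log (1 - z) := by
  have h := Complex.hasSum_taylorSeries_neg_log hz
  rw [← hasSum_nat_add_iff' 1] at h
  simpa [cpolylog] using h.tsum_eq

lemma cpolylog_conj (s : ℕ) (z : ℂ) :
    cpolylog s (starRingEnd ℂ z) = starRingEnd ℂ (cpolylog s z) := by
  simp [cpolylog, Complex.conj_tsum]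

lemma hasDerivAt_cpolylog_comp (s : ℕ) {f : ℝ → ℂ} {l : ℂ} {t : ℝ} (hf : HasDerivAt f (f t * l) t)
    (h1 : ‖f t‖ < 1) :
    HasDerivAt (fun t => cpolylog (s + 1) (f t)) (cpolylog s (f t) * l) t := by
  have := (hasDerivAt_cpolylog_succ s h1).comp_of_eq t hf rfl
  refine this.congr_deriv ?_
  rw [cpolylog_eq_mul_polylogQuot]
  ring

/-! ### Two curves ending at `(1 ± i) / 2` -/

lemma cos_pos_of_mem_Icc_quarter {t : ℝ} (ht : t ∈ Icc 0 (π / 4)) : 0 < cos t :=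
  cos_pos_of_mem_Ioo ⟨by linarith [ht.1, pi_pos], by linarith [ht.2, pi_pos]⟩

lemma sin_pos_of_mem_Ioo_quarter {t : ℝ} (ht : t ∈ Ioo 0 (π / 4)) : 0 < sin t :=
  sin_pos_of_pos_of_lt_pi ht.1 (by linarith [ht.2, pi_pos])

lemma sqrt_two_div_two_le_cos {t : ℝ} (ht : t ∈ Icc 0 (π / 4)) : √2 / 2 ≤ cos t := by
  rw [← cos_pi_div_four]
  exact cos_le_cos_of_nonneg_of_le_pi ht.1 (by linarith [pi_pos]) ht.2

lemma sqrt_two_div_two_lt_one : √2 / 2 < 1 := by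
  nlinarith [Real.sq_sqrt (show (0 : ℝ) ≤ 2 by norm_num), Real.sqrt_nonneg 2]

lemma log_two_mul_sqrt_two_div_two : log (2 * (√2 / 2)) = log 2 / 2 := by
  rw [show 2 * (√2 / 2) = √2 by ring, log_sqrt (by norm_num)]

lemma log_sqrt_two_div_two : log (√2 / 2) = -(log 2 / 2) := by
  rw [log_div (by positivity) (by norm_num), log_sqrt (by norm_num)]
  ring

/-- The vertical segment from `1 / 2` to `(1 - i) / 2`, parametrised by the angle. -/
noncomputable def segmentCurve (t : ℝ) : ℂ := Complex.exp (-(t * Complex.I)) / (2 * cos t : ℝ)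

/-- The arc of the circle with diameter `[0, 1]` from `0` to `(1 + i) / 2`. -/
noncomputable def arcCurve (t : ℝ) : ℂ := Complex.I * (sin t : ℝ) * Complex.exp (-(t * Complex.I))

lemma exp_neg_mul_I (t : ℝ) :
    Complex.exp (-(t * Complex.I)) = (cos t : ℝ) - (sin t : ℝ) * Complex.I := by
  rw [← neg_mul, Complex.exp_mul_I]
  push_cast
  rw [Complex.cos_neg, Complex.sin_neg]
  ring

lemma norm_segmentCurve_lt_one {t : ℝ} (ht : t ∈ Icc 0 (π / 4)) : ‖segmentCurve t‖ < 1 := by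
  have h := sqrt_two_div_two_le_cos ht
  have h1 : ‖Complex.exp (-(t * Complex.I))‖ = 1 := by
    rw [← neg_mul, ← Complex.ofReal_neg]; exact Complex.norm_exp_ofReal_mul_I _
  have hc := cos_pos_of_mem_Icc_quarter ht
  rw [segmentCurve, norm_div, h1, Complex.norm_real, Real.norm_of_nonneg (by positivity),
    div_lt_one (by positivity)]
  nlinarith [Real.lt_sqrt (x := 1) (y := 2) (by norm_num) |>.2 (by norm_num)]

lemma norm_arcCurve {t : ℝ} : ‖arcCurve t‖ = |sin t| := by
  have h1 : ‖Complex.exp (-(t * Complex.I))‖ = 1 := by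
    rw [← neg_mul, ← Complex.ofReal_neg]; exact Complex.norm_exp_ofReal_mul_I _
  rw [arcCurve, norm_mul, norm_mul, h1, Complex.norm_real]
  simp

lemma norm_arcCurve_le {t : ℝ} (ht : t ∈ Icc 0 (π / 4)) : ‖arcCurve t‖ ≤ √2 / 2 := by
  have h0 : 0 ≤ sin t := sin_nonneg_of_nonneg_of_le_pi ht.1 (by linarith [ht.2, pi_pos])
  rw [norm_arcCurve, abs_of_nonneg h0, ← sin_pi_div_four]
  exact sin_le_sin_of_le_of_le_pi_div_two (by linarith [ht.1, pi_pos]) (by linarith [pi_pos]) ht.2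

lemma norm_arcCurve_lt_one {t : ℝ} (ht : t ∈ Icc 0 (π / 4)) : ‖arcCurve t‖ < 1 :=
  (norm_arcCurve_le ht).trans_lt sqrt_two_div_two_lt_one

lemma hasDerivAt_exp_neg_mul_I (t : ℝ) :
    HasDerivAt (fun t : ℝ => Complex.exp (-(t * Complex.I)))
      (Complex.exp (-(t * Complex.I)) * (-Complex.I)) t := by
  have := ((Complex.ofRealCLM.hasDerivAt (x := t)).mul_const Complex.I).neg.cexp
  simpa using this

lemma hasDerivAt_segmentCurve {t : ℝ} (ht : cos t ≠ 0) :
    HasDerivAt segmentCurve (segmentCurve t * ((sin t / cos t : ℝ) - Complex.I)) t := by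
  have hc : ((2 * cos t : ℝ) : ℂ) ≠ 0 := by exact_mod_cast mul_ne_zero two_ne_zero ht
  have := (hasDerivAt_exp_neg_mul_I t).div
    ((((hasDerivAt_cos t).const_mul 2)).ofReal_comp) hc
  refine this.congr_deriv ?_
  have hc' : ((cos t : ℝ) : ℂ) ≠ 0 := by exact_mod_cast ht
  rw [segmentCurve]
  push_cast at hc' ⊢
  field_simp
  ring

lemma hasDerivAt_arcCurve {t : ℝ} (ht : sin t ≠ 0) :
    HasDerivAt arcCurve (arcCurve t * ((cos t / sin t : ℝ) - Complex.I)) t := by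
  have := (((hasDerivAt_sin t).ofReal_comp).const_mul Complex.I).mul (hasDerivAt_exp_neg_mul_I t)
  refine this.congr_deriv ?_
  have hc' : ((sin t : ℝ) : ℂ) ≠ 0 := by exact_mod_cast ht
  rw [arcCurve]
  push_cast at hc' ⊢
  field_simp
  ring

lemma log_one_sub_segmentCurve {t : ℝ} (ht : t ∈ Icc 0 (π / 4)) :
    Complex.log (1 - segmentCurve t) = -(log (2 * cos t) : ℝ) + t * Complex.I := by
  have hc := cos_pos_of_mem_Icc_quarter ht
  have hc' : ((cos t : ℝ) : ℂ) ≠ 0 := by exact_mod_cast hc.ne'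
  have key : 1 - segmentCurve t = Complex.exp (-(log (2 * cos t) : ℝ) + t * Complex.I) := by
    rw [Complex.exp_add, Complex.exp_neg, ← Complex.ofReal_exp, exp_log (by positivity),
      segmentCurve, exp_neg_mul_I, Complex.exp_mul_I]
    push_cast at hc' ⊢
    field_simp
    ring
  rw [key, Complex.log_exp] <;> simp <;> linarith [ht.1, ht.2, pi_pos]

lemma log_one_sub_arcCurve {t : ℝ} (ht : t ∈ Icc 0 (π / 4)) :
    Complex.log (1 - arcCurve t) = (log (cos t) : ℝ) - t * Complex.I := by
  have hc := cos_pos_of_mem_Icc_quarter ht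
  have key : 1 - arcCurve t = Complex.exp ((log (cos t) : ℝ) - t * Complex.I) := by
    rw [sub_eq_add_neg ((log (cos t) : ℝ) : ℂ), Complex.exp_add, ← Complex.ofReal_exp, exp_log hc,
      arcCurve, exp_neg_mul_I]
    have h := congrArg (fun x : ℝ => (x : ℂ)) (sin_sq_add_cos_sq t)
    push_cast at h ⊢
    linear_combination (Complex.sin t) ^ 2 * Complex.I_sq - h
  rw [key, Complex.log_exp] <;> simp <;> linarith [ht.1, ht.2, pi_pos]

lemma segmentCurve_zero : segmentCurve 0 = ((1 / 2 : ℝ) : ℂ) := by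
  simp [segmentCurve]

lemma segmentCurve_pi_div_four :
    segmentCurve (π / 4) = starRingEnd ℂ ((1 + Complex.I) / 2) := by
  rw [segmentCurve, exp_neg_mul_I, sin_pi_div_four, cos_pi_div_four]
  have h : ((√2 : ℝ) : ℂ) ≠ 0 := by exact_mod_cast (by positivity : √2 ≠ 0)
  simp [Complex.conj_ofNat]
  field_simp
  ring

lemma arcCurve_zero : arcCurve 0 = 0 := by simp [arcCurve]

lemma arcCurve_pi_div_four : arcCurve (π / 4) = (1 + Complex.I) / 2 := by
  rw [arcCurve, exp_neg_mul_I, sin_pi_div_four, cos_pi_div_four]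
  have h : ((√2 : ℝ) : ℂ) ^ 2 = 2 := by
    rw [← Complex.ofReal_pow, Real.sq_sqrt (by norm_num)]; norm_num
  push_cast
  linear_combination (Complex.I - Complex.I ^ 2) / 4 * h - Complex.I_sq / 2

lemma cpolylog_ofReal_im (s : ℕ) (x : ℝ) : (cpolylog s x).im = 0 := by
  rw [← Complex.conj_eq_iff_im, ← cpolylog_conj, Complex.conj_ofReal]

lemma HasDerivAt.complex_im {f : ℝ → ℂ} {f' : ℂ} {t : ℝ} (h : HasDerivAt f f' t) :
    HasDerivAt (fun t => (f t).im) f'.im t :=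
  Complex.imCLM.hasFDerivAt.comp_hasDerivAt t h

lemma hasDerivAt_log_two_mul_cos {t : ℝ} (ht : cos t ≠ 0) :
    HasDerivAt (fun t => log (2 * cos t)) (-(sin t / cos t)) t := by
  have := ((hasDerivAt_cos t).const_mul 2).log (mul_ne_zero two_ne_zero ht)
  refine this.congr_deriv ?_
  field_simp

lemma hasDerivAt_log_sin {t : ℝ} (ht : sin t ≠ 0) :
    HasDerivAt (fun t => log (sin t)) (cos t / sin t) t := (hasDerivAt_sin t).log ht

lemma hasDerivAt_log_cos {t : ℝ} (ht : cos t ≠ 0) :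
    HasDerivAt (fun t => log (cos t)) (-(sin t / cos t)) t := by
  have := (hasDerivAt_cos t).log ht
  refine this.congr_deriv ?_
  ring

lemma hasDerivAt_cpolylog_two_segmentCurve {t : ℝ} (ht : t ∈ Icc 0 (π / 4)) :
    HasDerivAt (fun t => cpolylog 2 (segmentCurve t))
      (((log (2 * cos t) : ℝ) - t * Complex.I) * ((sin t / cos t : ℝ) - Complex.I)) t := by
  have hc := cos_pos_of_mem_Icc_quarter ht
  have := hasDerivAt_cpolylog_comp 1 (hasDerivAt_segmentCurve hc.ne') (norm_segmentCurve_lt_one ht)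
  refine this.congr_deriv ?_
  rw [cpolylog_one (norm_segmentCurve_lt_one ht), log_one_sub_segmentCurve ht]
  ring

lemma hasDerivAt_cpolylog_two_arcCurve {t : ℝ} (ht : t ∈ Ioo 0 (π / 4)) :
    HasDerivAt (fun t => cpolylog 2 (arcCurve t))
      ((-(log (cos t) : ℝ) + t * Complex.I) * ((cos t / sin t : ℝ) - Complex.I)) t := by
  have hs := sin_pos_of_mem_Ioo_quarter ht
  have ht' := Ioo_subset_Icc_self ht
  have := hasDerivAt_cpolylog_comp 1 (hasDerivAt_arcCurve hs.ne') (norm_arcCurve_lt_one ht')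
  refine this.congr_deriv ?_
  rw [cpolylog_one (norm_arcCurve_lt_one ht'), log_one_sub_arcCurve ht']
  ring

lemma continuousOn_log_two_mul_cos : ContinuousOn (fun t => log (2 * cos t)) (Icc 0 (π / 4)) :=
  ContinuousOn.log (by fun_prop) fun t ht => by
    have := cos_pos_of_mem_Icc_quarter ht
    positivity

/-- `Im Li₂((1+i)/2)` through the integral of `log (2 cos)`. -/
lemma im_cpolylog_two :
    (cpolylog 2 ((1 + Complex.I) / 2)).im =
      2 * (∫ t in 0..π / 4, log (2 * cos t)) - π / 8 * log 2 := by
  have h4 : (0 : ℝ) ≤ π / 4 := by positivity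
  have hd : ∀ t ∈ uIcc 0 (π / 4), HasDerivAt
      (fun t => (cpolylog 2 (segmentCurve t)).im - t * log (2 * cos t))
      (-2 * log (2 * cos t)) t := by
    intro t ht
    rw [uIcc_of_le h4] at ht
    have hc := cos_pos_of_mem_Icc_quarter ht
    refine ((hasDerivAt_cpolylog_two_segmentCurve ht).complex_im.sub
      ((hasDerivAt_id t).mul (hasDerivAt_log_two_mul_cos hc.ne'))).congr_deriv ?_
    simp only [Complex.mul_im, Complex.sub_re, Complex.sub_im, Complex.ofReal_re, Complex.ofReal_im,
      Complex.mul_re, Complex.I_re, Complex.I_im, id]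
    ring
  have hi : IntervalIntegrable (fun t => -2 * log (2 * cos t)) volume 0 (π / 4) :=
    (ContinuousOn.intervalIntegrable
      (by rw [uIcc_of_le h4]; exact continuousOn_log_two_mul_cos)).const_mul _
  have := integral_eq_sub_of_hasDerivAt hd hi
  rw [intervalIntegral.integral_const_mul, segmentCurve_pi_div_four, segmentCurve_zero,
    cpolylog_conj, cpolylog_ofReal_im, Complex.conj_im, cos_pi_div_four,
    log_two_mul_sqrt_two_div_two] at this
  linarith

/-- `Im Li₃((1+i)/2)` through the integral of `log² (2 cos)`. -/
lemma im_cpolylog_three_eq_integral_segment :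
    (cpolylog 3 ((1 + Complex.I) / 2)).im + log 2 / 2 * (cpolylog 2 ((1 + Complex.I) / 2)).im
        - π / 4 * (cpolylog 2 ((1 + Complex.I) / 2)).re =
      ∫ t in 0..π / 4, (log (2 * cos t) ^ 2 + t ^ 2) := by
  have h4 : (0 : ℝ) ≤ π / 4 := by positivity
  have hd : ∀ t ∈ uIcc 0 (π / 4), HasDerivAt
      (fun t => (cpolylog 3 (segmentCurve t) +
        ((log (2 * cos t) : ℝ) + t * Complex.I) * cpolylog 2 (segmentCurve t)).im)
      (-(log (2 * cos t) ^ 2 + t ^ 2)) t := by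
    intro t ht
    rw [uIcc_of_le h4] at ht
    have hc := cos_pos_of_mem_Icc_quarter ht
    have h3 := hasDerivAt_cpolylog_comp 2 (hasDerivAt_segmentCurve hc.ne')
      (norm_segmentCurve_lt_one ht)
    have hid : HasDerivAt (fun t : ℝ => (t : ℂ) * Complex.I) Complex.I t := by
      simpa using (Complex.ofRealCLM.hasDerivAt (x := t)).mul_const Complex.I
    refine (h3.add (((hasDerivAt_log_two_mul_cos hc.ne').ofReal_comp.add hid).mul
      (hasDerivAt_cpolylog_two_segmentCurve ht))).complex_im.congr_deriv ?_
    simp only [Complex.mul_im, Complex.sub_re, Complex.sub_im, Complex.ofReal_re, Complex.ofReal_im,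
      Complex.mul_re, Complex.I_re, Complex.I_im, Complex.add_im, Complex.add_re, Pi.add_apply]
    ring
  have hi : IntervalIntegrable (fun t => -(log (2 * cos t) ^ 2 + t ^ 2)) volume 0 (π / 4) :=
    ContinuousOn.intervalIntegrable (by
      rw [uIcc_of_le h4]
      exact ((continuousOn_log_two_mul_cos.pow 2).add (by fun_prop)).neg)
  have := integral_eq_sub_of_hasDerivAt hd hi
  rw [intervalIntegral.integral_neg, segmentCurve_pi_div_four, segmentCurve_zero,
    cpolylog_conj, cpolylog_conj, cos_pi_div_four,
    log_two_mul_sqrt_two_div_two] at this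
  simp only [Complex.add_im, Complex.mul_im, Complex.add_re, Complex.ofReal_re, Complex.ofReal_im,
    Complex.mul_re, Complex.I_re, Complex.I_im, Complex.conj_re, Complex.conj_im,
    cpolylog_ofReal_im] at this
  linarith

lemma continuousOn_log_cos : ContinuousOn (fun t => log (cos t)) (uIcc 0 (π / 4)) := by
  rw [uIcc_of_le (by positivity)]
  exact ContinuousOn.log (by fun_prop) fun t ht => (cos_pos_of_mem_Icc_quarter ht).ne'

lemma intervalIntegrable_log_sin_mul_log_cos :
    IntervalIntegrable (fun t => log (sin t) * log (cos t)) volume 0 (π / 4) :=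
  intervalIntegrable_log_sin.mul_continuousOn continuousOn_log_cos

lemma IntervalIntegrable.mul_cot_mul {h : ℝ → ℝ} (hh : IntervalIntegrable h volume 0 (π / 4)) :
    IntervalIntegrable (fun t => t * (cos t / sin t) * h t) volume 0 (π / 4) := by
  have h4 : (0 : ℝ) ≤ π / 4 := by positivity
  have hsc : ContinuousOn (fun t => cos t / sinc t) (uIcc 0 (π / 4)) := by
    refine (by fun_prop : ContinuousOn cos _).div continuous_sinc.continuousOn fun t ht => ?_
    rw [uIcc_of_le h4] at ht
    rcases eq_or_lt_of_le ht.1 with h | h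
    · rw [← h]; simp
    · rw [sinc_of_ne_zero h.ne']
      exact (div_pos (sin_pos_of_pos_of_lt_pi h (by linarith [ht.2, pi_pos])) h).ne'
  refine (hh.continuousOn_mul hsc).congr fun t ht => ?_
  rw [uIoc_of_le h4] at ht
  have := ht.1.ne'
  simp only [sinc_of_ne_zero this]
  field_simp

/-- The arc evaluation of `Im Li₃((1+i)/2)`. -/
lemma im_cpolylog_three_eq_integral_arc :
    (cpolylog 3 ((1 + Complex.I) / 2)).im + log 2 / 2 * (cpolylog 2 ((1 + Complex.I) / 2)).im
        + π / 4 * (cpolylog 2 ((1 + Complex.I) / 2)).re =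
      -(∫ t in 0..π / 4, log (sin t) * log (cos t)) + π ^ 3 / 192
        - ∫ t in 0..π / 4, t * (cos t / sin t) * (log (sin t) + log (cos t)) := by
  have h4 : (0 : ℝ) ≤ π / 4 := by positivity
  set F : ℝ → ℝ := fun t => (cpolylog 3 (arcCurve t) -
        ((log (sin t) : ℝ) - t * Complex.I) * cpolylog 2 (arcCurve t)).im with hF
  have hd : ∀ t ∈ Ioo 0 (π / 4), HasDerivAt F (-(log (sin t) * log (cos t)) + t ^ 2
      - t * (cos t / sin t) * (log (sin t) + log (cos t))) t := by
    intro t ht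
    have hs := sin_pos_of_mem_Ioo_quarter ht
    have h3 := hasDerivAt_cpolylog_comp 2 (hasDerivAt_arcCurve hs.ne')
      (norm_arcCurve_lt_one (Ioo_subset_Icc_self ht))
    have hid : HasDerivAt (fun t : ℝ => (t : ℂ) * Complex.I) Complex.I t := by
      simpa using (Complex.ofRealCLM.hasDerivAt (x := t)).mul_const Complex.I
    refine (h3.sub (((hasDerivAt_log_sin hs.ne').ofReal_comp.sub hid).mul
      (hasDerivAt_cpolylog_two_arcCurve ht))).complex_im.congr_deriv ?_
    simp only [Complex.mul_im, Complex.sub_re, Complex.sub_im, Complex.ofReal_re, Complex.ofReal_im,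
      Complex.mul_re, Complex.I_re, Complex.I_im, Complex.add_im, Complex.add_re, Pi.sub_apply,
      Complex.neg_re, Complex.neg_im]
    ring
  have hcont : ContinuousOn F (Icc 0 (π / 4)) := by
    have harc : Continuous arcCurve := by unfold arcCurve; fun_prop
    have hq (s : ℕ) : ContinuousOn (fun t => polylogQuot s (arcCurve t)) (Icc 0 (π / 4)) :=
      (continuousOn_polylogQuot s (by positivity) sqrt_two_div_two_lt_one).comp
        harc.continuousOn fun t ht => by simpa using norm_arcCurve_le ht
    have hsl : Continuous fun t => sin t * log (sin t) := continuous_mul_log.comp continuous_sin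
    have : ContinuousOn (fun t => (arcCurve t * polylogQuot 3 (arcCurve t) -
        (Complex.I * ((sin t * log (sin t) : ℝ) : ℂ) * Complex.exp (-(t * Complex.I))
          - t * Complex.I * arcCurve t) * polylogQuot 2 (arcCurve t)).im) (Icc 0 (π / 4)) := by
      refine Complex.continuous_im.comp_continuousOn ?_
      refine (harc.continuousOn.mul (hq 3)).sub (ContinuousOn.mul ?_ (hq 2))
      refine Continuous.continuousOn ?_
      exact ((continuous_const.mul (Complex.continuous_ofReal.comp hsl)).mul (by fun_prop)).sub
        (by fun_prop)
    refine this.congr fun t _ => ?_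
    simp only [hF]
    congr 1
    rw [cpolylog_eq_mul_polylogQuot, cpolylog_eq_mul_polylogQuot]
    generalize polylogQuot 3 (arcCurve t) = a
    generalize polylogQuot 2 (arcCurve t) = b
    rw [arcCurve]
    push_cast
    ring
  have hi1 := intervalIntegrable_log_sin_mul_log_cos
  have hi2 : IntervalIntegrable (fun t => t * (cos t / sin t) * (log (sin t) + log (cos t)))
      volume 0 (π / 4) :=
    (intervalIntegrable_log_sin.add continuousOn_log_cos.intervalIntegrable).mul_cot_mul
  have hi3 : IntervalIntegrable (fun t : ℝ => t ^ 2) volume 0 (π / 4) :=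
    (continuous_pow 2).intervalIntegrable _ _
  have hi1' : IntervalIntegrable (fun t => -(log (sin t) * log (cos t))) volume 0 (π / 4) := hi1.neg
  have := integral_eq_sub_of_hasDerivAt_of_le h4 hcont hd ((hi1'.add hi3).sub hi2)
  rw [intervalIntegral.integral_sub (hi1'.add hi3) hi2, intervalIntegral.integral_add hi1' hi3,
    intervalIntegral.integral_neg, integral_pow] at this
  simp only [hF, arcCurve_pi_div_four, arcCurve_zero, sin_pi_div_four, log_sqrt_two_div_two] at this
  have h0 (s : ℕ) : cpolylog s 0 = 0 := by simp [cpolylog]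
  rw [h0, h0] at this
  simp only [Complex.sub_im, Complex.mul_im, Complex.sub_re, Complex.ofReal_re, Complex.ofReal_im,
    Complex.mul_re, Complex.I_re, Complex.I_im, Complex.zero_im, Complex.zero_re] at this
  norm_num at this
  linarith

/-! ### Termwise integration of even power series on the unit interval -/

lemma hasSum_integral_even_powers {c : ℕ → ℝ} {h G : ℝ → ℝ}
    (hhi : IntervalIntegrable h volume 0 1) (hpos : ∀ x ∈ Ioo (0 : ℝ) 1, 0 ≤ h x)
    (hs : Summable fun k => |c k| * ∫ x in (0 : ℝ)..1, x ^ (2 * k) * h x)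
    (hG : ∀ x ∈ Ioo (0 : ℝ) 1, HasSum (fun k => c k * x ^ (2 * k)) (G x)) :
    HasSum (fun k => c k * ∫ x in (0 : ℝ)..1, x ^ (2 * k) * h x)
      (∫ x in (0 : ℝ)..1, G x * h x) := by
  have key : ∀ g : ℝ → ℝ, ∫ x in (0 : ℝ)..1, g x = ∫ x in Ioo (0 : ℝ) 1, g x := fun g => by
    rw [integral_of_le zero_le_one, integral_Ioc_eq_integral_Ioo]
  have hi (k : ℕ) : IntervalIntegrable (fun x => x ^ (2 * k) * h x) volume 0 1 :=
    hhi.continuousOn_mul (by fun_prop)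
  have hnorm (k : ℕ) : ∫ x in Ioo (0 : ℝ) 1, ‖c k * (x ^ (2 * k) * h x)‖ =
      |c k| * ∫ x in (0 : ℝ)..1, x ^ (2 * k) * h x := by
    rw [key, ← MeasureTheory.integral_const_mul]
    refine setIntegral_congr_fun measurableSet_Ioo fun x hx => ?_
    have := hpos x hx
    have := hx.1.le
    simp only [norm_mul, Real.norm_eq_abs]
    rw [abs_of_nonneg (by positivity : 0 ≤ x ^ (2 * k)), abs_of_nonneg (hpos x hx)]
  have := hasSum_integral_of_summable_integral_norm (μ := volume.restrict (Ioo (0 : ℝ) 1))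
    (F := fun k x => c k * (x ^ (2 * k) * h x))
    (fun k => (((intervalIntegrable_iff_integrableOn_Ioo_of_le zero_le_one).1 (hi k)).const_mul _))
    (by simpa only [hnorm] using hs)
  have e1 : (fun k => c k * ∫ x in (0 : ℝ)..1, x ^ (2 * k) * h x) =
      fun k => ∫ x in Ioo (0 : ℝ) 1, c k * (x ^ (2 * k) * h x) := by
    funext k
    rw [key, ← MeasureTheory.integral_const_mul]
  have e2 : ∫ x in Ioo (0 : ℝ) 1, G x * h x =
      ∫ x in Ioo (0 : ℝ) 1, ∑' k, c k * (x ^ (2 * k) * h x) := by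
    refine setIntegral_congr_fun measurableSet_Ioo fun x hx => ?_
    have := ((hG x hx).mul_right (h x)).tsum_eq
    simp only [← this, mul_assoc]
  rw [key, e1, e2]
  exact this

lemma integral_pow_mul_neg_log (n : ℕ) :
    ∫ x in (0 : ℝ)..1, x ^ n * -log x = 1 / ((n : ℝ) + 1) ^ 2 := by
  have hn : (n : ℝ) + 1 ≠ 0 := by positivity
  have hcont : Continuous fun x : ℝ =>
      -(x ^ n * (x * log x)) / ((n : ℝ) + 1) + x ^ (n + 1) / ((n : ℝ) + 1) ^ 2 := by
    have := continuous_mul_log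
    fun_prop
  have hd : ∀ x ∈ Ioo (0 : ℝ) 1, HasDerivAt (fun x : ℝ =>
      -(x ^ n * (x * log x)) / ((n : ℝ) + 1) + x ^ (n + 1) / ((n : ℝ) + 1) ^ 2)
      (x ^ n * -log x) x := by
    intro x hx
    have hx0 : x ≠ 0 := hx.1.ne'
    have h1 := ((hasDerivAt_pow (n + 1) x).mul (hasDerivAt_log hx0)).neg.div_const ((n : ℝ) + 1)
    have h2 := (hasDerivAt_pow (n + 1) x).div_const (((n : ℝ) + 1) ^ 2)
    have := h1.add h2
    refine HasDerivAt.congr_of_eventuallyEq (f := _) (this.congr_deriv ?_)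
      (Eventually.of_forall fun y => ?_)
    · push_cast
      field_simp
      ring
    · simp
      ring
  have hi : IntervalIntegrable (fun x : ℝ => x ^ n * -log x) volume 0 1 :=
    (intervalIntegrable_log' (a := 0) (b := 1)).neg.continuousOn_mul (by fun_prop)
  rw [integral_eq_sub_of_hasDerivAt_of_le zero_le_one hcont.continuousOn hd hi]
  simp

lemma intervalIntegrable_and_integral_pow_mul_log_sq (n : ℕ) :
    IntervalIntegrable (fun x : ℝ => x ^ n * log x ^ 2) volume 0 1 ∧
    ∫ x in (0 : ℝ)..1, x ^ n * log x ^ 2 = 2 / ((n : ℝ) + 1) ^ 3 := by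
  have hn : (n : ℝ) + 1 ≠ 0 := by positivity
  set F : ℝ → ℝ := fun x : ℝ => x ^ n * (x * log x ^ 2) / ((n : ℝ) + 1)
      - 2 * (x ^ n * (x * log x)) / ((n : ℝ) + 1) ^ 2 + 2 * x ^ (n + 1) / ((n : ℝ) + 1) ^ 3 with hF
  have hsq : ContinuousOn (fun x : ℝ => x * log x ^ 2) (Icc 0 1) := by
    have : Continuous fun x : ℝ => 4 * (√x * log √x) ^ 2 :=
      ((continuous_mul_log.comp continuous_sqrt).pow 2).const_mul 4
    refine this.continuousOn.congr fun x hx => ?_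
    simp only [mul_pow, Real.sq_sqrt hx.1, log_sqrt hx.1]
    ring
  have hcont : ContinuousOn F (Icc 0 1) := by
    have := continuous_mul_log.continuousOn (s := Icc (0 : ℝ) 1)
    fun_prop
  have hd : ∀ x ∈ Ioo (0 : ℝ) 1, HasDerivAt F (x ^ n * log x ^ 2) x := by
    intro x hx
    have hx0 : x ≠ 0 := hx.1.ne'
    have hl := hasDerivAt_log hx0
    have hp := hasDerivAt_pow (n + 1) x
    have := (((hp.mul (hl.pow 2)).div_const ((n : ℝ) + 1)).sub
      (((hp.mul hl).const_mul 2).div_const (((n : ℝ) + 1) ^ 2))).add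
      ((hp.const_mul 2).div_const (((n : ℝ) + 1) ^ 3))
    refine HasDerivAt.congr_of_eventuallyEq (this.congr_deriv ?_)
      (Eventually.of_forall fun y => ?_)
    · push_cast
      simp only [Pi.pow_apply]
      field_simp
      ring
    · simp [hF]
      ring
  have hi : IntervalIntegrable (fun x : ℝ => x ^ n * log x ^ 2) volume 0 1 := by
    refine intervalIntegrable_deriv_of_nonneg (g := F) (by rwa [uIcc_of_le zero_le_one])
      (by simpa using hd) fun x hx => ?_
    have : 0 < x := by simpa using hx.1
    positivity
  refine ⟨hi, ?_⟩
  rw [integral_eq_sub_of_hasDerivAt_of_le zero_le_one hcont hd hi]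
  simp [hF]

lemma sum_pow_add_sum_neg_pow (k : ℕ) (x : ℝ) :
    ∑ j ∈ Finset.range (2 * k + 1), x ^ j + ∑ j ∈ Finset.range (2 * k + 1), (-x) ^ j =
      2 * ∑ i ∈ Finset.range (k + 1), x ^ (2 * i) := by
  induction k with
  | zero => simp; norm_num
  | succ k ih =>
    rw [show 2 * (k + 1) + 1 = 2 * k + 1 + 1 + 1 by ring, Finset.sum_range_succ,
      Finset.sum_range_succ _ (2 * k + 1), Finset.sum_range_succ (fun j => (-x) ^ j),
      Finset.sum_range_succ (fun j => (-x) ^ j), Finset.sum_range_succ _ (k + 1), mul_add, ← ih,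
      Odd.neg_pow (⟨k, rfl⟩ : Odd (2 * k + 1)),
      Even.neg_pow (⟨k + 1, by ring⟩ : Even (2 * k + 1 + 1))]
    ring

lemma intervalIntegrable_log_one_sub_sq :
    IntervalIntegrable (fun x : ℝ => log (1 - x ^ 2)) volume 0 1 := by
  have h1 : IntervalIntegrable (fun x : ℝ => log (1 - x)) volume 0 1 := by
    have := (intervalIntegrable_log' (a := 0) (b := 1)).comp_sub_left 1
    simpa using this.symm
  have h2 : IntervalIntegrable (fun x : ℝ => log (1 + x)) volume 0 1 := by
    refine ContinuousOn.intervalIntegrable (ContinuousOn.log (by fun_prop) fun x hx => ?_)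
    rw [uIcc_of_le zero_le_one] at hx
    linarith [hx.1]
  refine (h1.add h2).congr_uIoo fun x hx => ?_
  rw [uIoo_of_le zero_le_one] at hx
  simp only
  rw [← log_mul (by linarith [hx.2]) (by linarith [hx.1])]
  congr 1
  ring

lemma integral_pow_mul_neg_log_one_sub_sq (k : ℕ) :
    ∫ x in (0 : ℝ)..1, x ^ (2 * k) * -log (1 - x ^ 2) =
      2 * (∑ i ∈ Finset.range (k + 1), 1 / (2 * (i : ℝ) + 1) - log 2) / (2 * (k : ℝ) + 1) := by
  have hn : 2 * (k : ℝ) + 1 ≠ 0 := by positivity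
  set F : ℝ → ℝ := fun x => (∑ j ∈ Finset.range (2 * k + 1), x ^ j) * ((1 - x) * log (1 - x))
    - (x ^ (2 * k + 1) + 1) * log (1 + x)
    + 2 * ∑ i ∈ Finset.range (k + 1), x ^ (2 * i + 1) / (2 * (i : ℝ) + 1) with hF
  have hcont : ContinuousOn F (Icc 0 1) := by
    have h1 : Continuous fun x : ℝ => (1 - x) * log (1 - x) :=
      continuous_mul_log.comp (by fun_prop : Continuous fun x : ℝ => 1 - x)
    have h2 : ContinuousOn (fun x : ℝ => log (1 + x)) (Icc 0 1) :=
      ContinuousOn.log (by fun_prop) fun x hx => by linarith [hx.1]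
    have h1' := h1.continuousOn (s := Icc (0 : ℝ) 1)
    fun_prop
  have hd : ∀ x ∈ Ioo (0 : ℝ) 1, HasDerivAt F
      ((2 * (k : ℝ) + 1) * (x ^ (2 * k) * -log (1 - x ^ 2))) x := by
    intro x hx
    have hx1 : 1 - x ≠ 0 := by linarith [hx.2]
    have hx2 : 1 + x ≠ 0 := by linarith [hx.1]
    have hp := hasDerivAt_pow (2 * k + 1) x
    have hl1 := ((hasDerivAt_id x).const_sub 1).log hx1
    have hl2 := ((hasDerivAt_id x).const_add 1).log hx2
    have hsum : HasDerivAt (fun x : ℝ => ∑ i ∈ Finset.range (k + 1),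
        x ^ (2 * i + 1) / (2 * (i : ℝ) + 1))
        (∑ i ∈ Finset.range (k + 1), x ^ (2 * i)) x := by
      refine HasDerivAt.fun_sum fun i _ => ?_
      have := (hasDerivAt_pow (2 * i + 1) x).div_const (2 * (i : ℝ) + 1)
      refine this.congr_deriv ?_
      have : 2 * (i : ℝ) + 1 ≠ 0 := by positivity
      push_cast
      field_simp
    have := (((hp.const_sub 1).mul hl1).sub ((hp.add_const 1).mul hl2)).add (hsum.const_mul 2)
    refine HasDerivAt.congr_of_eventuallyEq (this.congr_deriv ?_)
      (Eventually.of_forall fun y => ?_)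
    · have hlog : log (1 - x ^ 2) = log (1 - x) + log (1 + x) := by
        rw [← log_mul hx1 hx2]; congr 1; ring
      have g1 := mul_neg_geom_sum x (2 * k + 1)
      have g2 := mul_neg_geom_sum (-x) (2 * k + 1)
      rw [Odd.neg_pow (⟨k, rfl⟩ : Odd (2 * k + 1)), sub_neg_eq_add, sub_neg_eq_add] at g2
      rw [← sum_pow_add_sum_neg_pow, hlog]
      simp only [Nat.add_sub_cancel, id]
      rw [← g1, show x ^ (2 * k + 1) + 1 = (1 + x) * ∑ j ∈ Finset.range (2 * k + 1), (-x) ^ j by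
        rw [g2]; ring]
      push_cast
      field_simp
      ring
    · have g1 := mul_neg_geom_sum y (2 * k + 1)
      simp [hF]
      rw [← g1]
      ring
  have hi : IntervalIntegrable (fun x : ℝ => (2 * (k : ℝ) + 1) * (x ^ (2 * k) * -log (1 - x ^ 2)))
      volume 0 1 :=
    (intervalIntegrable_log_one_sub_sq.neg.continuousOn_mul (by fun_prop)).const_mul _
  have := integral_eq_sub_of_hasDerivAt_of_le zero_le_one hcont hd hi
  rw [intervalIntegral.integral_const_mul] at this
  rw [eq_div_iff hn, mul_comm, this]
  simp [hF]
  norm_num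
  ring

/-! ### Alternating series over the odd integers -/

lemma injective_two_mul_add_one : Function.Injective fun k : ℕ => 2 * k + 1 := fun a b h => by
  simpa using h

lemma summable_one_div_odd_pow {p : ℕ} (hp : 1 < p) :
    Summable fun k : ℕ => 1 / (2 * (k : ℝ) + 1) ^ p := by
  have := (Real.summable_one_div_nat_pow.2 hp).comp_injective injective_two_mul_add_one
  refine this.congr fun k => ?_
  simp

lemma hasSum_catalanConst :
    HasSum (fun k : ℕ => (-1 : ℝ) ^ k * (1 / (2 * (k : ℝ) + 1) ^ 2)) catalanConst := by
  have : Summable fun k : ℕ => (-1 : ℝ) ^ k * (1 / (2 * (k : ℝ) + 1) ^ 2) := by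
    refine Summable.of_norm ((summable_one_div_odd_pow one_lt_two).congr fun k => ?_)
    rw [norm_mul, norm_pow, norm_neg, norm_one, one_pow, one_mul,
        Real.norm_of_nonneg (by positivity)]
  convert! this.hasSum using 1
  simp [catalanConst, div_eq_mul_inv]

lemma hasSum_alternating_odd_cubes :
    HasSum (fun k : ℕ => (-1 : ℝ) ^ k * (1 / (2 * (k : ℝ) + 1) ^ 3)) (π ^ 3 / 32) := by
  have h := hasSum_L_function_mod_four_eval_three
  rw [← injective_two_mul_add_one.hasSum_iff] at h
  · convert! h using 1
    funext k
    have : π * ((2 * k + 1 : ℕ) : ℝ) / 2 = k * π + π / 2 := by push_cast; ring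
    simp only [Function.comp]
    rw [this, Real.sin_add_pi_div_two, Real.cos_nat_mul_pi]
    push_cast
    ring
  · intro n hn
    have : Even n := by
      by_contra hodd
      obtain ⟨k, rfl⟩ := Nat.not_even_iff_odd.1 hodd
      exact hn ⟨k, rfl⟩
    obtain ⟨m, rfl⟩ := this
    have : π * ((m + m : ℕ) : ℝ) / 2 = m * π := by push_cast; ring
    rw [this, Real.sin_nat_mul_pi, mul_zero]

/-- The odd harmonic sum `1 + 1/3 + ⋯ + 1/(2n-1)`. -/
noncomputable def oddHarmonic (n : ℕ) : ℝ := ∑ i ∈ Finset.range n, 1 / (2 * (i : ℝ) + 1)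

lemma oddHarmonic_nonneg (n : ℕ) : 0 ≤ oddHarmonic n :=
  Finset.sum_nonneg fun _ _ => by positivity

lemma oddHarmonic_succ (n : ℕ) : oddHarmonic (n + 1) = oddHarmonic n + 1 / (2 * (n : ℝ) + 1) :=
  Finset.sum_range_succ _ _

lemma oddHarmonic_succ_le_sqrt (k : ℕ) : oddHarmonic (k + 1) ≤ √(2 * (k : ℝ) + 1) := by
  induction k with
  | zero => simp [oddHarmonic]
  | succ k ih =>
    rw [oddHarmonic_succ]
    push_cast
    set a := √(2 * (k : ℝ) + 1) with ha
    set b := √(2 * ((k : ℝ) + 1) + 1) with hb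
    have ha2 : a ^ 2 = 2 * (k : ℝ) + 1 := Real.sq_sqrt (by positivity)
    have hb2 : b ^ 2 = 2 * ((k : ℝ) + 1) + 1 := Real.sq_sqrt (by positivity)
    have ha0 : 0 ≤ a := Real.sqrt_nonneg _
    have hb1 : 1 ≤ b := Real.one_le_sqrt.2 (by have : (0:ℝ) ≤ k := k.cast_nonneg; linarith)
    have hab : a ≤ b := Real.sqrt_le_sqrt (by linarith)
    rw [← hb2]
    have : 1 / b ^ 2 ≤ b - a := by
      rw [div_le_iff₀ (by positivity)]
      nlinarith [mul_nonneg (sub_nonneg.2 hab) (sub_nonneg.2 hab),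
          mul_nonneg (sub_nonneg.2 hab) (sub_nonneg.2 hb1)]
    linarith

lemma summable_oddHarmonic_div_sq :
    Summable fun k : ℕ => oddHarmonic (k + 1) / (2 * (k : ℝ) + 1) ^ 2 := by
  have h := (Real.summable_nat_rpow.2 (by norm_num : (-(3 / 2) : ℝ) < -1)).comp_injective
    injective_two_mul_add_one
  refine Summable.of_nonneg_of_le (fun k => div_nonneg (oddHarmonic_nonneg _) (by positivity))
    (fun k => ?_) h
  simp only [Function.comp]
  push_cast
  have hp : (0 : ℝ) < 2 * k + 1 := by positivity
  rw [div_le_iff₀ (by positivity), ← Real.rpow_natCast (2 * (k : ℝ) + 1) 2, ← Real.rpow_add hp]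
  convert! oddHarmonic_succ_le_sqrt k using 1
  rw [Real.sqrt_eq_rpow]
  norm_num

/-- The Euler-type sum `∑ (-1)^k (1 + 1/3 + ⋯ + 1/(2k+1)) / (2k+1)²`. -/
noncomputable def oddEulerSum : ℝ :=
  ∑' k : ℕ, (-1 : ℝ) ^ k * (oddHarmonic (k + 1) / (2 * (k : ℝ) + 1) ^ 2)

lemma hasSum_oddEulerSum :
    HasSum (fun k : ℕ => (-1 : ℝ) ^ k * (oddHarmonic (k + 1) / (2 * (k : ℝ) + 1) ^ 2))
      oddEulerSum := by
  refine Summable.hasSum (Summable.of_norm (summable_oddHarmonic_div_sq.congr fun k => ?_))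
  have := oddHarmonic_nonneg (k + 1)
  rw [norm_mul, norm_pow, norm_neg, norm_one, one_pow, one_mul, Real.norm_of_nonneg (by positivity)]

lemma hasSum_one_div_one_add_sq {x : ℝ} (hx : x ∈ Ioo (0 : ℝ) 1) :
    HasSum (fun k : ℕ => (-1 : ℝ) ^ k * x ^ (2 * k)) (1 / (1 + x ^ 2)) := by
  have := hasSum_geometric_of_abs_lt_one (r := -x ^ 2) (by
    rw [abs_neg, abs_of_nonneg (by positivity)]
    nlinarith [hx.1, hx.2])
  rw [sub_neg_eq_add, ← one_div] at this
  refine this.congr_fun fun k => ?_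
  rw [neg_pow (x ^ 2), pow_mul]

lemma hasSum_arctan_div {x : ℝ} (hx : x ∈ Ioo (0 : ℝ) 1) :
    HasSum (fun k : ℕ => (-1 : ℝ) ^ k * (1 / (2 * (k : ℝ) + 1)) * x ^ (2 * k)) (arctan x / x) := by
  have := (Real.hasSum_arctan (x := x) (by
    rw [Real.norm_of_nonneg hx.1.le]; exact hx.2)).div_const x
  refine this.congr_fun fun k => ?_
  have := hx.1.ne'
  push_cast
  field_simp
  ring

lemma hasSum_arctan_div_mul_one_add_sq {x : ℝ} (hx : x ∈ Ioo (0 : ℝ) 1) :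
    HasSum (fun k : ℕ => (-1 : ℝ) ^ k * oddHarmonic (k + 1) * x ^ (2 * k))
      (arctan x / x * (1 / (1 + x ^ 2))) := by
  have h1 := hasSum_arctan_div hx
  have h2 := hasSum_one_div_one_add_sq hx
  have hn2 : Summable fun k : ℕ => ‖(-1 : ℝ) ^ k * x ^ (2 * k)‖ := h2.summable.norm
  have hn1 : Summable fun k : ℕ => ‖(-1 : ℝ) ^ k * (1 / (2 * (k : ℝ) + 1)) * x ^ (2 * k)‖ :=
    h1.summable.norm
  have := hasSum_sum_range_mul_of_summable_norm hn1 hn2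
  rw [h1.tsum_eq, h2.tsum_eq] at this
  refine this.congr_fun fun k => ?_
  rw [oddHarmonic, Finset.mul_sum, Finset.sum_mul]
  refine Finset.sum_congr rfl fun i hi => ?_
  have hik : i + (k - i) = k := by have := Finset.mem_range.1 hi; omega
  have h1 : (-1 : ℝ) ^ k = (-1) ^ i * (-1) ^ (k - i) := by rw [← pow_add, hik]
  have h2 : x ^ (2 * k) = x ^ (2 * i) * x ^ (2 * (k - i)) := by rw [← pow_add, ← mul_add, hik]
  rw [h1, h2]
  ring

lemma abs_neg_one_pow_mul (k : ℕ) {a : ℝ} (ha : 0 ≤ a) : |(-1 : ℝ) ^ k * a| = a := by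
  rw [abs_mul, abs_pow, abs_neg, abs_one, one_pow, one_mul, abs_of_nonneg ha]

lemma neg_log_nonneg_of_mem_Ioo {x : ℝ} (hx : x ∈ Ioo (0 : ℝ) 1) : 0 ≤ -log x :=
  neg_nonneg.2 (log_nonpos hx.1.le hx.2.le)

lemma intervalIntegrable_neg_log : IntervalIntegrable (fun x : ℝ => -log x) volume 0 1 :=
  (intervalIntegrable_log' (a := 0) (b := 1)).neg

lemma integral_inv_one_add_sq_mul_neg_log :
    ∫ x in (0 : ℝ)..1, 1 / (1 + x ^ 2) * -log x = catalanConst := by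
  have hI (k : ℕ) := integral_pow_mul_neg_log (2 * k)
  push_cast at hI
  have := hasSum_integral_even_powers (c := fun k => (-1) ^ k) intervalIntegrable_neg_log
    (fun x hx => neg_log_nonneg_of_mem_Ioo hx)
    ((summable_one_div_odd_pow one_lt_two).congr fun k => by simp [hI, -mul_neg])
    (fun x hx => hasSum_one_div_one_add_sq hx)
  simp only [hI] at this
  exact this.unique hasSum_catalanConst

lemma integral_inv_one_add_sq_mul_log_sq :
    ∫ x in (0 : ℝ)..1, 1 / (1 + x ^ 2) * log x ^ 2 = π ^ 3 / 16 := by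
  have hI (k : ℕ) := (intervalIntegrable_and_integral_pow_mul_log_sq (2 * k)).2
  push_cast at hI
  have := hasSum_integral_even_powers (c := fun k => (-1) ^ k)
    (by simpa using (intervalIntegrable_and_integral_pow_mul_log_sq 0).1)
    (fun x _ => sq_nonneg (log x))
    (by simpa [hI, div_eq_mul_inv] using
      (summable_one_div_odd_pow (p := 3) (by norm_num)).mul_left 2)
    (fun x hx => hasSum_one_div_one_add_sq hx)
  simp only [hI] at this
  refine this.unique ?_
  convert! hasSum_alternating_odd_cubes.mul_left 2 using 1
  · funext k; ring
  · ring

lemma integral_arctan_div_mul_neg_log :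
    ∫ x in (0 : ℝ)..1, arctan x / x * -log x = π ^ 3 / 32 := by
  have hI (k : ℕ) := integral_pow_mul_neg_log (2 * k)
  push_cast at hI
  have hc (k : ℕ) : 1 / (2 * (k : ℝ) + 1) * (1 / (2 * (k : ℝ) + 1) ^ 2) =
      1 / (2 * (k : ℝ) + 1) ^ 3 := by
    rw [div_mul_div_comm, one_mul, pow_succ' _ 2]
  have := hasSum_integral_even_powers (c := fun k => (-1) ^ k * (1 / (2 * (k : ℝ) + 1)))
    intervalIntegrable_neg_log (fun x hx => neg_log_nonneg_of_mem_Ioo hx)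
    ((summable_one_div_odd_pow (p := 3) (by norm_num)).congr fun k => by
      rw [hI, abs_neg_one_pow_mul k (by positivity), hc])
    (fun x hx => hasSum_arctan_div hx)
  simp only [hI, mul_assoc, hc] at this
  exact this.unique hasSum_alternating_odd_cubes

lemma integral_arctan_div_mul_inv_one_add_sq_mul_neg_log :
    ∫ x in (0 : ℝ)..1, arctan x / x * (1 / (1 + x ^ 2)) * -log x = oddEulerSum := by
  have hI (k : ℕ) := integral_pow_mul_neg_log (2 * k)
  push_cast at hI
  have := hasSum_integral_even_powers (c := fun k => (-1) ^ k * oddHarmonic (k + 1))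
    intervalIntegrable_neg_log (fun x hx => neg_log_nonneg_of_mem_Ioo hx)
    (summable_oddHarmonic_div_sq.congr fun k => by
      rw [hI, abs_neg_one_pow_mul k (oddHarmonic_nonneg _), mul_one_div])
    (fun x hx => hasSum_arctan_div_mul_one_add_sq hx)
  simp only [hI, mul_assoc, mul_one_div (oddHarmonic _)] at this
  simp only [mul_assoc]
  exact this.unique hasSum_oddEulerSum

lemma integral_arctan_div_mul_neg_log_one_sub_sq :
    ∫ x in (0 : ℝ)..1, arctan x / x * -log (1 - x ^ 2) =
      2 * oddEulerSum - 2 * log 2 * catalanConst := by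
  have hI (k : ℕ) := integral_pow_mul_neg_log_one_sub_sq k
  have hc (k : ℕ) :
      1 / (2 * (k : ℝ) + 1) * (2 * (oddHarmonic (k + 1) - log 2) / (2 * (k : ℝ) + 1)) =
      2 * (oddHarmonic (k + 1) / (2 * (k : ℝ) + 1) ^ 2)
        - 2 * log 2 * (1 / (2 * (k : ℝ) + 1) ^ 2) := by
    have : 2 * (k : ℝ) + 1 ≠ 0 := by positivity
    field_simp
  have := hasSum_integral_even_powers (c := fun k => (-1) ^ k * (1 / (2 * (k : ℝ) + 1)))
    intervalIntegrable_log_one_sub_sq.neg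
    (fun x hx => neg_nonneg.2 (log_nonpos (by nlinarith [hx.1, hx.2]) (by nlinarith [hx.1])))
    (((summable_oddHarmonic_div_sq.mul_left 2).sub
      ((summable_one_div_odd_pow one_lt_two).mul_left (2 * log 2))).congr fun k => by
      simp only [Pi.neg_apply]
      rw [hI, abs_neg_one_pow_mul k (by positivity)]
      exact (hc k).symm)
    (fun x hx => hasSum_arctan_div hx)
  simp only [Pi.neg_apply] at this
  refine this.unique ?_
  convert! (hasSum_oddEulerSum.mul_left 2).sub (hasSum_catalanConst.mul_left (2 * log 2)) using 1
  funext k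
  rw [hI, mul_assoc]
  change (-1) ^ k * (1 / (2 * (k : ℝ) + 1) *
    (2 * (oddHarmonic (k + 1) - log 2) / (2 * (k : ℝ) + 1))) = _
  rw [hc]
  ring

/-! ### Log-trigonometric integrals on the quarter interval -/

lemma image_arctan_Ioo_zero_one : arctan '' Ioo 0 1 = Ioo 0 (π / 4) := by
  ext y
  constructor
  · rintro ⟨x, hx, rfl⟩
    refine ⟨arctan_pos.2 hx.1, ?_⟩
    rw [← arctan_one]
    exact arctan_strictMono hx.2
  · intro hy
    have hlt : -(π / 2) < y := by linarith [hy.1, pi_pos]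
    have hlt' : y < π / 2 := by linarith [hy.2, pi_pos]
    have hat := arctan_tan hlt hlt'
    refine ⟨tan y, ⟨tan_pos_of_pos_of_lt_pi_div_two hy.1 hlt', ?_⟩, hat⟩
    rw [← arctan_strictMono.lt_iff_lt, hat, arctan_one]
    exact hy.2

lemma integral_comp_tan (g : ℝ → ℝ) :
    ∫ t in (0 : ℝ)..π / 4, g (tan t) = ∫ x in (0 : ℝ)..1, 1 / (1 + x ^ 2) * g x := by
  rw [integral_of_le zero_le_one, integral_of_le (by positivity), integral_Ioc_eq_integral_Ioo,
    integral_Ioc_eq_integral_Ioo, ← image_arctan_Ioo_zero_one,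
    integral_image_eq_integral_abs_deriv_smul measurableSet_Ioo
      (fun x _ => (hasDerivAt_arctan x).hasDerivWithinAt) arctan_injective.injOn]
  refine setIntegral_congr_fun measurableSet_Ioo fun x _ => ?_
  simp only [tan_arctan, smul_eq_mul]
  rw [abs_of_nonneg (by positivity)]

lemma intervalIntegrable_comp_tan_iff (g : ℝ → ℝ) :
    IntervalIntegrable (fun t => g (tan t)) volume 0 (π / 4) ↔
      IntervalIntegrable (fun x => 1 / (1 + x ^ 2) * g x) volume 0 1 := by
  rw [intervalIntegrable_iff_integrableOn_Ioo_of_le zero_le_one,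
    intervalIntegrable_iff_integrableOn_Ioo_of_le (by positivity), ← image_arctan_Ioo_zero_one,
    integrableOn_image_iff_integrableOn_abs_deriv_smul measurableSet_Ioo
      (fun x _ => (hasDerivAt_arctan x).hasDerivWithinAt) arctan_injective.injOn]
  refine integrableOn_congr_fun (fun x _ => ?_) measurableSet_Ioo
  simp only [tan_arctan, smul_eq_mul]
  rw [abs_of_nonneg (by positivity)]

lemma log_tan_of_mem_Ioo {t : ℝ} (ht : t ∈ Ioo 0 (π / 4)) :
    log (tan t) = log (sin t) - log (cos t) := by
  rw [tan_eq_sin_div_cos, log_div (sin_pos_of_mem_Ioo_quarter ht).ne'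
    (cos_pos_of_mem_Icc_quarter (Ioo_subset_Icc_self ht)).ne']

lemma integral_congr_Ioo_quarter {f g : ℝ → ℝ} (h : ∀ t ∈ Ioo 0 (π / 4), f t = g t) :
    ∫ t in 0..π / 4, f t = ∫ t in 0..π / 4, g t := by
  rw [integral_of_le (by positivity), integral_of_le (by positivity), integral_Ioc_eq_integral_Ioo,
    integral_Ioc_eq_integral_Ioo]
  exact setIntegral_congr_fun measurableSet_Ioo h

lemma integral_log_sin_sub_log_cos :
    ∫ t in 0..π / 4, (log (sin t) - log (cos t)) = -catalanConst := by
  have := integral_comp_tan fun x => -log x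
  rw [integral_inv_one_add_sq_mul_neg_log] at this
  rw [← this, intervalIntegral.integral_neg, neg_neg]
  exact integral_congr_Ioo_quarter fun t ht => (log_tan_of_mem_Ioo ht).symm

lemma integral_sq_log_sin_sub_log_cos :
    ∫ t in 0..π / 4, (log (sin t) - log (cos t)) ^ 2 = π ^ 3 / 16 := by
  have := integral_comp_tan fun x => log x ^ 2
  rw [integral_inv_one_add_sq_mul_log_sq] at this
  rw [← this]
  exact integral_congr_Ioo_quarter fun t ht => by rw [log_tan_of_mem_Ioo ht]

lemma intervalIntegrable_log_sin_fun (a b : ℝ) :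
    IntervalIntegrable (fun t => log (sin t)) volume a b := intervalIntegrable_log_sin

lemma intervalIntegrable_sq_log_sin_sub_log_cos :
    IntervalIntegrable (fun t => (log (sin t) - log (cos t)) ^ 2) volume 0 (π / 4) := by
  have h1 : IntervalIntegrable (fun x => log x ^ 2) volume 0 1 := by
    simpa using (intervalIntegrable_and_integral_pow_mul_log_sq 0).1
  have h2 := (intervalIntegrable_comp_tan_iff fun x => log x ^ 2).2
    (h1.continuousOn_mul (Continuous.continuousOn (by
      refine continuous_const.div (by fun_prop) fun x => ?_
      positivity)))
  refine h2.congr_uIoo fun t ht => ?_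
  rw [uIoo_of_le (by positivity)] at ht
  simp only [log_tan_of_mem_Ioo ht]

lemma intervalIntegrable_log_sin_sq :
    IntervalIntegrable (fun t => log (sin t) ^ 2) volume 0 (π / 4) := by
  have hc := continuousOn_log_cos
  have h1 := intervalIntegrable_sq_log_sin_sub_log_cos
  have h2 := intervalIntegrable_log_sin_mul_log_cos.const_mul 2
  have h3 := (hc.pow 2).intervalIntegrable (μ := volume)
  refine ((h1.add h2).sub h3).congr fun t _ => ?_
  simp only [Pi.pow_apply]
  ring

lemma integral_mul_cot_mul_log_sub :
    ∫ t in 0..π / 4, t * (cos t / sin t) * (log (sin t) - log (cos t)) = -oddEulerSum := by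
  have := integral_comp_tan fun x => arctan x / x * -log x
  rw [← neg_eq_iff_eq_neg, ← integral_arctan_div_mul_inv_one_add_sq_mul_neg_log,
    ← intervalIntegral.integral_neg]
  have e : ∀ x : ℝ, arctan x / x * (1 / (1 + x ^ 2)) * -log x =
    1 / (1 + x ^ 2) * (arctan x / x * -log x) := fun x => by ring
  simp only [e]
  rw [← this]
  refine integral_congr_Ioo_quarter fun t ht => ?_
  rw [log_tan_of_mem_Ioo ht, arctan_tan (by linarith [ht.1, pi_pos]) (by linarith [ht.2, pi_pos]),
    tan_eq_sin_div_cos]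
  field_simp

lemma integral_half_eq_integral_quarter {f : ℝ → ℝ}
    (h1 : IntervalIntegrable f volume 0 (π / 4))
    (h2 : IntervalIntegrable (fun t => f (π / 2 - t)) volume 0 (π / 4)) :
    ∫ t in 0..π / 2, f t = ∫ t in 0..π / 4, (f t + f (π / 2 - t)) := by
  have e : π / 2 - π / 4 = π / 4 := by ring
  have h2' : IntervalIntegrable f volume (π / 4) (π / 2) := by
    have := h2.comp_sub_left (π / 2)
    simpa [e] using this.symm
  rw [← integral_add_adjacent_intervals h1 h2', intervalIntegral.integral_add h1 h2,
    intervalIntegral.integral_comp_sub_left (f := f), e, sub_zero]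

lemma integral_log_sin_add_log_cos :
    ∫ t in 0..π / 4, (log (sin t) + log (cos t)) = -(π / 2) * log 2 := by
  have := integral_half_eq_integral_quarter (f := fun t => log (sin t)) intervalIntegrable_log_sin
    (by simp only [sin_pi_div_two_sub]; exact intervalIntegrable_log_cos)
  simp only [sin_pi_div_two_sub] at this
  rw [← this, integral_log_sin_zero_pi_div_two]
  ring

lemma integral_sq_log_sin_add_log_cos :
    ∫ t in 0..π / 4, (log (sin t) + log (cos t) + 2 * log 2) ^ 2 =
      1 / 2 * ∫ t in 0..π / 4, ((log (sin t) + log 2) ^ 2 + (log (cos t) + log 2) ^ 2) := by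
  have hs : IntervalIntegrable (fun t => (log (sin t) + log 2) ^ 2) volume 0 (π / 4) := by
    refine ((intervalIntegrable_log_sin_sq.add
      ((intervalIntegrable_log_sin_fun _ _).const_mul (2 * log 2))).add
      (intervalIntegrable_const (c := log 2 ^ 2))).congr fun t _ => ?_
    ring
  have hc : IntervalIntegrable (fun t => (log (cos t) + log 2) ^ 2) volume 0 (π / 4) :=
    ((continuousOn_log_cos.add continuousOn_const).pow 2).intervalIntegrable
  have h1 := integral_half_eq_integral_quarter (f := fun t => (log (sin t) + log 2) ^ 2) hs
    (by simpa only [sin_pi_div_two_sub] using hc)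
  simp only [sin_pi_div_two_sub] at h1
  have h2 := intervalIntegral.integral_comp_mul_left (a := 0) (b := π / 4)
    (f := fun t => (log (sin t) + log 2) ^ 2) two_ne_zero
  rw [mul_zero, show 2 * (π / 4) = π / 2 by ring, h1, smul_eq_mul] at h2
  rw [one_div, ← h2]
  refine integral_congr_Ioo_quarter fun t ht => ?_
  have p1 := (sin_pos_of_mem_Ioo_quarter ht).ne'
  have p2 := (cos_pos_of_mem_Icc_quarter (Ioo_subset_Icc_self ht)).ne'
  rw [sin_two_mul, log_mul (mul_ne_zero two_ne_zero p1) p2, log_mul two_ne_zero p1]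
  ring

lemma two_mul_integral_mul_cot_mul_log_sin :
    2 * ∫ t in 0..π / 4, t * (cos t / sin t) * log (sin t) =
      π * log 2 ^ 2 / 16 - ∫ t in 0..π / 4, log (sin t) ^ 2 := by
  have h4 : (0 : ℝ) ≤ π / 4 := by positivity
  set F : ℝ → ℝ := fun t => t * log (sin t) ^ 2 with hF
  have hcont : ContinuousOn F (Icc 0 (π / 4)) := by
    have h1 : Continuous fun t : ℝ => 4 * (√(sin t) * log √(sin t)) ^ 2 :=
      ((continuous_mul_log.comp (continuous_sqrt.comp continuous_sin)).pow 2).const_mul 4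
    have h2 : ContinuousOn (fun t => 1 / sinc t) (Icc 0 (π / 4)) := by
      refine continuousOn_const.div continuous_sinc.continuousOn fun t ht => ?_
      rcases eq_or_lt_of_le ht.1 with h | h
      · rw [← h]; simp
      · rw [sinc_of_ne_zero h.ne']
        exact (div_pos (sin_pos_of_pos_of_lt_pi h (by linarith [ht.2, pi_pos])) h).ne'
    refine (h2.mul h1.continuousOn).congr fun t ht => ?_
    rcases eq_or_lt_of_le ht.1 with h | h
    · rw [← h]; simp [hF]
    · have hs := sin_pos_of_pos_of_lt_pi h (by linarith [ht.2, pi_pos])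
      simp only [hF, Pi.mul_apply, sinc_of_ne_zero h.ne', mul_pow, Real.sq_sqrt hs.le,
        log_sqrt hs.le]
      field_simp
      ring
  have hd : ∀ t ∈ Ioo 0 (π / 4), HasDerivAt F
      (log (sin t) ^ 2 + 2 * (t * (cos t / sin t) * log (sin t))) t := by
    intro t ht
    have hs := (sin_pos_of_mem_Ioo_quarter ht).ne'
    refine ((hasDerivAt_id t).mul ((hasDerivAt_log_sin hs).pow 2)).congr_deriv ?_
    simp
    ring
  have hi := (intervalIntegrable_log_sin_fun 0 (π / 4)).mul_cot_mul.const_mul 2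
  have := integral_eq_sub_of_hasDerivAt_of_le h4 hcont hd (intervalIntegrable_log_sin_sq.add hi)
  rw [intervalIntegral.integral_add intervalIntegrable_log_sin_sq hi,
    intervalIntegral.integral_const_mul] at this
  simp only [hF, sin_pi_div_four, log_sqrt_two_div_two] at this
  linarith

/-- The Euler-type sum in terms of `Im Li₃((1+i)/2)`. -/
lemma oddEulerSum_eq : oddEulerSum =
    π ^ 3 / 16 + π * log 2 ^ 2 / 16 - 2 * (cpolylog 3 ((1 + Complex.I) / 2)).im := by
  have hs : IntervalIntegrable (fun t => log (sin t)) volume 0 (π / 4) :=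
    intervalIntegrable_log_sin
  have hc := continuousOn_log_cos.intervalIntegrable (μ := volume)
  have hss := intervalIntegrable_log_sin_sq
  have hcc : IntervalIntegrable (fun t => log (cos t) ^ 2) volume 0 (π / 4) :=
    (continuousOn_log_cos.pow 2).intervalIntegrable
  have hsc := intervalIntegrable_log_sin_mul_log_cos
  have hk (a : ℝ) : IntervalIntegrable (fun _ => a) volume 0 (π / 4) := intervalIntegrable_const
  have e1 := integral_log_sin_sub_log_cos
  have e2 := integral_sq_log_sin_sub_log_cos
  have e3 := integral_log_sin_add_log_cos
  have e4 := integral_sq_log_sin_add_log_cos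
  have e5 := im_cpolylog_two
  have e6 := im_cpolylog_three_eq_integral_segment
  have e7 := im_cpolylog_three_eq_integral_arc
  have e8 : ∫ t in 0..π / 4, t * (cos t / sin t) * (log (sin t) + log (cos t)) =
      2 * (∫ t in 0..π / 4, t * (cos t / sin t) * log (sin t)) -
      ∫ t in 0..π / 4, t * (cos t / sin t) * (log (sin t) - log (cos t)) := by
    rw [← intervalIntegral.integral_const_mul, ← intervalIntegral.integral_sub
      (hs.mul_cot_mul.const_mul 2) (hs.sub hc).mul_cot_mul]
    exact integral_congr_Ioo_quarter fun t _ => by ring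
  rw [two_mul_integral_mul_cot_mul_log_sin, integral_mul_cot_mul_log_sub] at e8
  rw [e8] at e7
  set S := ∫ t in 0..π / 4, log (sin t)
  set M := ∫ t in 0..π / 4, log (cos t)
  set SS := ∫ t in 0..π / 4, log (sin t) ^ 2
  set MM := ∫ t in 0..π / 4, log (cos t) ^ 2
  set SM := ∫ t in 0..π / 4, log (sin t) * log (cos t)
  have lin (a b c d e f : ℝ) : ∫ t in 0..π / 4, (a * log (sin t) ^ 2 + b * log (cos t) ^ 2 +
      c * (log (sin t) * log (cos t)) + d * log (sin t) + e * log (cos t) + f) =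
      a * SS + b * MM + c * SM + d * S + e * M + f * (π / 4) := by
    have i1 := hss.const_mul a
    have i2 := hcc.const_mul b
    have i3 := hsc.const_mul c
    have i4 := hs.const_mul d
    have i5 := hc.const_mul e
    rw [intervalIntegral.integral_add ((((i1.add i2).add i3).add i4).add i5) (hk f),
      intervalIntegral.integral_add (((i1.add i2).add i3).add i4) i5,
      intervalIntegral.integral_add ((i1.add i2).add i3) i4,
      intervalIntegral.integral_add (i1.add i2) i3, intervalIntegral.integral_add i1 i2]
    simp only [intervalIntegral.integral_const_mul, intervalIntegral.integral_const, smul_eq_mul]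
    ring
  have l1 := lin 0 0 0 1 (-1) 0
  have l2 := lin 1 1 (-2) 0 0 0
  have l3 := lin 0 0 0 1 1 0
  have l4 := lin 1 1 2 (4 * log 2) (4 * log 2) (4 * log 2 ^ 2)
  have l5 := lin 1 1 0 (2 * log 2) (2 * log 2) (2 * log 2 ^ 2)
  have l6 := lin 0 0 0 0 1 (log 2)
  have l7 := lin 0 1 0 0 (2 * log 2) (log 2 ^ 2)
  have h7 : ∫ t in 0..π / 4, (log (2 * cos t) ^ 2 + t ^ 2) =
      (∫ t in 0..π / 4, log (2 * cos t) ^ 2) + π ^ 3 / 192 := by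
    have : IntervalIntegrable (fun t => log (2 * cos t) ^ 2) volume 0 (π / 4) :=
      ContinuousOn.intervalIntegrable (by
        rw [uIcc_of_le (by positivity)]; exact continuousOn_log_two_mul_cos.pow 2)
    rw [intervalIntegral.integral_add this ((continuous_pow 2).intervalIntegrable _ _),
        integral_pow]
    norm_num
    ring
  rw [h7] at e6
  have hlog : ∀ t ∈ Ioo 0 (π / 4), log (2 * cos t) = log 2 + log (cos t) := fun t ht =>
    log_mul two_ne_zero (cos_pos_of_mem_Icc_quarter (Ioo_subset_Icc_self ht)).ne'
  rw [← integral_congr_Ioo_quarter (f := fun t => log (sin t) - log (cos t)) fun t _ => by ring,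
      e1] at l1
  rw [← integral_congr_Ioo_quarter (f := fun t => (log (sin t) - log (cos t)) ^ 2)
      fun t _ => by ring, e2] at l2
  rw [← integral_congr_Ioo_quarter (f := fun t => log (sin t) + log (cos t)) fun t _ => by ring,
      e3] at l3
  rw [← integral_congr_Ioo_quarter (f := fun t => (log (sin t) + log (cos t) + 2 * log 2) ^ 2)
    fun t _ => by ring, e4] at l4
  rw [← integral_congr_Ioo_quarter
      (f := fun t => (log (sin t) + log 2) ^ 2 + (log (cos t) + log 2) ^ 2)
    fun t _ => by ring] at l5
  rw [← integral_congr_Ioo_quarter (f := fun t => log (2 * cos t))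
    fun t ht => by rw [hlog t ht]; ring] at l6
  rw [← integral_congr_Ioo_quarter (f := fun t => log (2 * cos t) ^ 2)
    fun t ht => by rw [hlog t ht]; ring] at l7
  rw [l5] at l4
  rw [l6] at e5
  rw [l7] at e6
  have hM : M = catalanConst / 2 - π / 4 * log 2 := by linarith
  have hS : S = -catalanConst / 2 - π / 4 * log 2 := by linarith
  rw [hM] at e5 e6
  rw [hM, hS] at l4
  rw [e5] at e6 e7
  linarith

/-! ### The kernel `log tan - log 2` on the half interval -/

/-- The kernel `log (tan p / 2)`, written through sine and cosine. -/
noncomputable def logTanHalf (p : ℝ) : ℝ := log (sin p) - log (cos p) - log 2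

lemma intervalIntegrable_logTanHalf (a b : ℝ) : IntervalIntegrable logTanHalf volume a b :=
  (intervalIntegrable_log_sin.sub intervalIntegrable_log_cos).sub intervalIntegrable_const

lemma IntervalIntegrable.div_sin_mul {h : ℝ → ℝ} (hh : IntervalIntegrable h volume 0 (π / 2)) :
    IntervalIntegrable (fun p => p / sin p * h p) volume 0 (π / 2) := by
  have h2 : (0 : ℝ) ≤ π / 2 := by positivity
  have hsc : ContinuousOn (fun p => 1 / sinc p) (uIcc 0 (π / 2)) := by
    refine continuousOn_const.div continuous_sinc.continuousOn fun t ht => ?_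
    rw [uIcc_of_le h2] at ht
    rcases eq_or_lt_of_le ht.1 with h | h
    · rw [← h]; simp
    · rw [sinc_of_ne_zero h.ne']
      exact (div_pos (sin_pos_of_pos_of_lt_pi h (by linarith [ht.2, pi_pos])) h).ne'
  refine (hh.continuousOn_mul hsc).congr fun t ht => ?_
  rw [uIoc_of_le h2] at ht
  simp only [sinc_of_ne_zero ht.1.ne', one_div_div]

lemma IntervalIntegrable.arctan_div_mul {h : ℝ → ℝ} (hh : IntervalIntegrable h volume 0 1) :
    IntervalIntegrable (fun x => arctan x / x * h x) volume 0 1 := by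
  have hc : ContinuousOn (dslope arctan 0) (uIcc 0 1) :=
    ((continuousOn_dslope univ_mem).2 ⟨continuous_arctan.continuousOn,
      differentiableAt_arctan 0⟩).mono (subset_univ _)
  refine (hh.continuousOn_mul hc).congr fun x hx => ?_
  rw [uIoc_of_le zero_le_one] at hx
  simp only [dslope_of_ne _ hx.1.ne', slope_def_field, arctan_zero, sub_zero]

lemma integral_arctan_div_mul_log_sub_log :
    ∫ x in (0 : ℝ)..1, arctan x / x * (log x - log (1 - x ^ 2)) =
      2 * oddEulerSum - 2 * log 2 * catalanConst - π ^ 3 / 32 := by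
  have h1 := intervalIntegrable_neg_log.arctan_div_mul
  have h2 := intervalIntegrable_log_one_sub_sq.neg.arctan_div_mul
  simp only [Pi.neg_apply] at h2
  rw [← integral_arctan_div_mul_neg_log, ← integral_arctan_div_mul_neg_log_one_sub_sq,
    ← intervalIntegral.integral_sub h2 h1]
  congr 1
  funext x
  ring

lemma integral_div_sin_mul_logTanHalf :
    ∫ p in 0..π / 2, p / sin p * logTanHalf p =
      3 * π ^ 3 / 16 - 4 * catalanConst * log 2 + π * log 2 ^ 2 / 4
        - 8 * (cpolylog 3 ((1 + Complex.I) / 2)).im := by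
  have h1 := intervalIntegral.integral_comp_mul_left (a := 0) (b := π / 4)
    (f := fun p => p / sin p * logTanHalf p) two_ne_zero
  rw [mul_zero, show 2 * (π / 4) = π / 2 by ring, smul_eq_mul] at h1
  have h2 := integral_comp_tan fun x =>
    (1 + x ^ 2) * (arctan x / x * (log x - log (1 - x ^ 2)))
  have h3 : ∀ x : ℝ, 1 / (1 + x ^ 2) * ((1 + x ^ 2) * (arctan x / x * (log x - log (1 - x ^ 2)))) =
      arctan x / x * (log x - log (1 - x ^ 2)) := fun x => by
    have : 1 + x ^ 2 ≠ 0 := by positivity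
    field_simp
  simp only [h3] at h2
  rw [integral_arctan_div_mul_log_sub_log, oddEulerSum_eq] at h2
  have h4 : ∫ t in 0..π / 4, 2 * t / sin (2 * t) * logTanHalf (2 * t) =
      ∫ t in 0..π / 4, (1 + tan t ^ 2) * (arctan (tan t) / tan t *
        (log (tan t) - log (1 - tan t ^ 2))) := by
    refine integral_congr_Ioo_quarter fun t ht => ?_
    have hs := sin_pos_of_mem_Ioo_quarter ht
    have hc := cos_pos_of_mem_Icc_quarter (Ioo_subset_Icc_self ht)
    have h2c : 0 < cos (2 * t) :=
      cos_pos_of_mem_Ioo ⟨by linarith [ht.1, pi_pos], by linarith [ht.2, pi_pos]⟩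
    have hlog : log (1 - tan t ^ 2) = log (cos (2 * t)) - 2 * log (cos t) := by
      rw [show 1 - tan t ^ 2 = cos (2 * t) / cos t ^ 2 by
        rw [tan_eq_sin_div_cos, cos_two_mul']; field_simp, log_div h2c.ne' (by positivity), log_pow]
      norm_num
    rw [hlog, log_tan_of_mem_Ioo ht, logTanHalf,
      arctan_tan (by linarith [ht.1, pi_pos]) (by linarith [ht.2, pi_pos]), sin_two_mul,
      log_mul (mul_ne_zero two_ne_zero hs.ne') hc.ne', log_mul two_ne_zero hs.ne',
      tan_eq_sin_div_cos]
    have : 1 + (sin t / cos t) ^ 2 = 1 / cos t ^ 2 := by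
      have := sin_sq_add_cos_sq t
      field_simp
      linarith
    rw [this]
    field_simp
    ring
  rw [h4, h2] at h1
  linarith

/-! ### A double series evaluation -/

lemma sum_range_two_mul_alternating (n : ℕ) :
    ∑ j ∈ Finset.range (2 * n), (-1 : ℝ) ^ j / ((j : ℝ) + 1) =
      ∑ i ∈ Finset.range n, (1 / (2 * (i : ℝ) + 1) - 1 / (2 * (i : ℝ) + 2)) := by
  induction n with
  | zero => simp
  | succ n ih =>
    rw [show 2 * (n + 1) = 2 * n + 1 + 1 by ring, Finset.sum_range_succ, Finset.sum_range_succ, ih,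
      Finset.sum_range_succ, pow_succ, pow_mul]
    push_cast
    norm_num
    ring

lemma sum_range_two_mul_alternating_eq_harmonic_sub (n : ℕ) :
    ∑ j ∈ Finset.range (2 * n), (-1 : ℝ) ^ j / ((j : ℝ) + 1) = harmonic (2 * n) - harmonic n := by
  rw [sum_range_two_mul_alternating]
  induction n with
  | zero => simp
  | succ n ih =>
    rw [Finset.sum_range_succ, ih, show 2 * (n + 1) = 2 * n + 1 + 1 by ring, harmonic_succ,
      harmonic_succ, harmonic_succ]
    push_cast
    have : (n : ℝ) + 1 ≠ 0 := by positivity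
    have : 2 * (n : ℝ) + 1 ≠ 0 := by positivity
    field_simp
    ring

lemma tendsto_alternating_harmonic :
    Tendsto (fun n => ∑ j ∈ Finset.range n, (-1 : ℝ) ^ j / ((j : ℝ) + 1)) atTop (𝓝 (log 2)) := by
  obtain ⟨l, hl⟩ := Antitone.tendsto_alternating_series_of_tendsto_zero
    (f := fun j : ℕ => 1 / ((j : ℝ) + 1))
    (fun a b hab => by
      have : (a : ℝ) ≤ b := by exact_mod_cast hab
      simp only
      gcongr) tendsto_one_div_add_atTop_nhds_zero_nat
  simp only [mul_one_div] at hl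
  have h2 : Tendsto (fun n : ℕ => 2 * n) atTop atTop := tendsto_id.const_mul_atTop' two_pos
  have h3 := hl.comp h2
  have h4 := ((tendsto_harmonic_sub_log.comp h2).sub tendsto_harmonic_sub_log).add_const (log 2)
  rw [sub_self, zero_add] at h4
  have h5 : Tendsto ((fun n => ∑ j ∈ Finset.range n, (-1 : ℝ) ^ j / ((j : ℝ) + 1)) ∘ fun n => 2 * n)
      atTop (𝓝 (log 2)) := by
    refine h4.congr' ?_
    filter_upwards [eventually_gt_atTop 0] with n hn
    have : (n : ℝ) ≠ 0 := by positivity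
    simp only [Function.comp, sum_range_two_mul_alternating_eq_harmonic_sub]
    push_cast
    rw [log_mul two_ne_zero this]
    ring
  rwa [tendsto_nhds_unique h3 h5] at hl

lemma hasSum_two_div_sub_one_div (k : ℕ) :
    HasSum (fun i : ℕ => 2 / (2 * (i : ℝ) + 1) - 1 / ((i : ℝ) + k + 1))
      (2 * log 2 + ∑ j ∈ Finset.range k, 1 / ((j : ℝ) + 1)) := by
  induction k with
  | zero =>
    rw [hasSum_iff_tendsto_nat_of_nonneg]
    · have h2 : Tendsto (fun n : ℕ => 2 * n) atTop atTop := tendsto_id.const_mul_atTop' two_pos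
      have := (tendsto_alternating_harmonic.comp h2).const_mul 2
      simp only [Finset.range_zero, Finset.sum_empty, add_zero]
      refine this.congr fun n => ?_
      simp only [Function.comp, sum_range_two_mul_alternating, Finset.mul_sum]
      refine Finset.sum_congr rfl fun i _ => ?_
      have : (i : ℝ) + 1 ≠ 0 := by positivity
      have : 2 * (i : ℝ) + 1 ≠ 0 := by positivity
      push_cast
      field_simp
      ring
    · intro i
      rw [sub_nonneg, div_le_div_iff₀ (by positivity) (by positivity)]
      push_cast
      linarith
  | succ k ih =>
    have h1 : HasSum (fun i : ℕ => 1 / ((i : ℝ) + k + 1) - 1 / ((i : ℝ) + (k + 1 : ℕ) + 1))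
        (1 / ((k : ℝ) + 1)) := by
      rw [hasSum_iff_tendsto_nat_of_nonneg]
      · have h := (tendsto_one_div_add_atTop_nhds_zero_nat (𝕜 := ℝ)).comp (tendsto_add_atTop_nat k)
        have h2 := h.const_sub (1 / ((k : ℝ) + 1))
        rw [sub_zero] at h2
        refine h2.congr fun n => ?_
        have := Finset.sum_range_sub' (fun i : ℕ => 1 / ((i : ℝ) + k + 1)) n
        simp only [Nat.cast_zero, zero_add] at this
        simp only [Function.comp]
        push_cast at this ⊢
        rw [← this]
        refine Finset.sum_congr rfl fun i _ => by ring
      · intro i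
        rw [sub_nonneg]
        push_cast
        gcongr
        linarith
    have := ih.add h1
    rw [Finset.sum_range_succ, ← add_assoc]
    refine this.congr_fun fun i => ?_
    ring

lemma hasSum_alternating_two_div_sub_one_div (k : ℕ) :
    HasSum (fun i : ℕ => (-1 : ℝ) ^ i * (2 / (2 * (i : ℝ) + 1) - 1 / ((i : ℝ) + k + 1)))
      (π / 2 - (-1) ^ k * (log 2 - ∑ j ∈ Finset.range k, (-1 : ℝ) ^ j / ((j : ℝ) + 1))) := by
  have hs : Summable fun i : ℕ =>
      (-1 : ℝ) ^ i * (2 / (2 * (i : ℝ) + 1) - 1 / ((i : ℝ) + k + 1)) := by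
    refine Summable.of_norm ((hasSum_two_div_sub_one_div k).summable.congr fun i => ?_)
    rw [Real.norm_eq_abs, abs_neg_one_pow_mul]
    rw [sub_nonneg, div_le_div_iff₀ (by positivity) (by positivity)]
    have : (0 : ℝ) ≤ k := k.cast_nonneg
    linarith
  have h1 := tendsto_sum_pi_div_four.const_mul 2
  have h2 := ((tendsto_alternating_harmonic.comp (tendsto_add_atTop_nat k)).sub_const
    (∑ j ∈ Finset.range k, (-1 : ℝ) ^ j / ((j : ℝ) + 1))).const_mul ((-1) ^ k)
  have h3 := h1.sub h2
  rw [show 2 * (π / 4) = π / 2 by ring] at h3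
  refine tendsto_nhds_unique hs.hasSum.tendsto_sum_nat (h3.congr fun n => ?_) ▸ hs.hasSum
  simp only [Function.comp]
  rw [Nat.add_comm n k, Finset.sum_range_add, add_sub_cancel_left, Finset.mul_sum, Finset.mul_sum,
    ← Finset.sum_sub_distrib]
  refine Finset.sum_congr rfl fun i _ => ?_
  have : ((-1 : ℝ) ^ k) * (-1) ^ k = 1 := by rw [← mul_pow]; simp
  push_cast
  rw [pow_add]
  linear_combination (-(-1 : ℝ) ^ i / ((k : ℝ) + i + 1)) * this

lemma hasSum_symmetrized {c : ℕ → ℝ} (hc : ∀ k, |c k| = 1) {Q : ℕ → ℝ}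
    (hQ : ∀ k : ℕ,
      HasSum (fun i : ℕ => c i * (2 / (2 * (i : ℝ) + 1) - 1 / ((i : ℝ) + k + 1))) (Q k))
    {A : ℝ} (hA : HasSum (fun k : ℕ => c k * (1 / (2 * (k : ℝ) + 1) ^ 2)) A) :
    HasSum (fun k => c k * (1 / (2 * (k : ℝ) + 1) ^ 3) * Q k) (A ^ 2) := by
  set f : ℕ → ℝ := fun k => c k * (1 / (2 * (k : ℝ) + 1) ^ 2) with hf
  set F : ℕ × ℕ → ℝ := fun p => c p.1 * (1 / (2 * (p.1 : ℝ) + 1) ^ 3) *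
    (c p.2 * (2 / (2 * (p.2 : ℝ) + 1) - 1 / ((p.2 : ℝ) + p.1 + 1))) with hF
  have hsym (p : ℕ × ℕ) : F p + F p.swap = 2 * (f p.1 * f p.2) := by
    obtain ⟨k, i⟩ := p
    simp only [hF, hf, Prod.swap]
    have : 2 * (k : ℝ) + 1 ≠ 0 := by positivity
    have : 2 * (i : ℝ) + 1 ≠ 0 := by positivity
    have h3 : (i : ℝ) + k + 1 ≠ 0 := by positivity
    rw [show (k : ℝ) + i + 1 = i + k + 1 by ring]
    field_simp
    ring
  have hfn : Summable fun k => ‖f k‖ := hA.summable.norm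
  have hff : Summable fun p : ℕ × ℕ => f p.1 * f p.2 := summable_mul_of_summable_norm hfn hfn
  have hle (p : ℕ × ℕ) : ‖F p‖ ≤ 2 * ‖f p.1 * f p.2‖ := by
    obtain ⟨k, i⟩ := p
    simp only [hF, hf, norm_mul, Real.norm_eq_abs, hc, one_mul]
    have hi : (0 : ℝ) ≤ i := i.cast_nonneg
    have hk : (0 : ℝ) ≤ k := k.cast_nonneg
    have h0 : 2 / (2 * (i : ℝ) + 1) - 1 / ((i : ℝ) + k + 1) =
        (2 * k + 1) / ((2 * i + 1) * (i + k + 1)) := by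
      field_simp
      ring
    rw [h0, abs_of_nonneg (by positivity), abs_of_nonneg (by positivity),
      abs_of_nonneg (by positivity), abs_of_nonneg (by positivity)]
    have h1 : 1 / (2 * (k : ℝ) + 1) ^ 3 * ((2 * k + 1) / ((2 * i + 1) * (i + k + 1))) =
        1 / ((2 * k + 1) ^ 2 * (2 * i + 1) * (i + k + 1)) := by
      field_simp
    have h2 : 2 * (1 / (2 * (k : ℝ) + 1) ^ 2 * (1 / (2 * (i : ℝ) + 1) ^ 2)) =
        1 / ((2 * k + 1) ^ 2 * (2 * i + 1) * (i + 1 / 2)) := by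
      field_simp
    rw [h1, h2]
    gcongr 1 / ((2 * (k : ℝ) + 1) ^ 2 * (2 * i + 1) * ?_)
    linarith
  have hFs : Summable F := Summable.of_norm_bounded (hff.norm.mul_left 2) hle
  have hsum : HasSum F (A ^ 2) := by
    have h1 := hFs.hasSum
    have h2 : HasSum (F ∘ Prod.swap) (∑' p, F p) := (Equiv.prodComm ℕ ℕ).hasSum_iff.2 h1
    have h3 := (hA.mul hA hff).mul_left 2
    have h4 := (h1.add h2).congr_fun (fun p => (hsym p).symm)
    have h5 := h4.unique h3
    convert h1 using 1
    linarith
  exact hsum.prod_fiberwise fun k => (hQ k).mul_left _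

lemma hasSum_one_div_odd_sq : HasSum (fun k : ℕ => 1 / (2 * (k : ℝ) + 1) ^ 2) (π ^ 2 / 8) := by
  have h1 := hasSum_zeta_two
  have h2 : HasSum (fun k : ℕ => 1 / ((2 * k : ℕ) : ℝ) ^ 2) (π ^ 2 / 24) := by
    have := h1.mul_left (1 / 4)
    rw [show 1 / 4 * (π ^ 2 / 6) = π ^ 2 / 24 by ring] at this
    refine this.congr_fun fun k => ?_
    push_cast
    rw [mul_pow, div_mul_div_comm]
    norm_num
  have h3 := (summable_one_div_odd_pow one_lt_two).hasSum
  have h4 := h2.even_add_odd (f := fun n : ℕ => 1 / (n : ℝ) ^ 2) (by push_cast; exact h3)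
  have := h4.unique h1
  convert h3 using 1
  linarith

/-- The sequence `log 2 + ∑_{j<k} (1 + (-1)^j)/(j+1)`. -/
noncomputable def dirichletLogCoeff (k : ℕ) : ℝ :=
  log 2 + ∑ j ∈ Finset.range k, (1 + (-1 : ℝ) ^ j) / ((j : ℝ) + 1)

lemma hasSum_dirichletLogCoeff :
    HasSum (fun k : ℕ => 1 / (2 * (k : ℝ) + 1) ^ 3 * dirichletLogCoeff k) (catalanConst ^ 2) := by
  have h1 := hasSum_symmetrized (c := fun _ => 1) (by simp)
    (fun k => by simpa only [one_mul] using hasSum_two_div_sub_one_div k)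
    (by simpa only [one_mul] using hasSum_one_div_odd_sq)
  have h2 := hasSum_symmetrized (c := fun k => (-1) ^ k) (by simp)
    hasSum_alternating_two_div_sub_one_div hasSum_catalanConst
  have h3 := (h1.add h2).sub (hasSum_alternating_odd_cubes.mul_left (π / 2))
  rw [show (π ^ 2 / 8) ^ 2 + catalanConst ^ 2 - π / 2 * (π ^ 3 / 32) =
      catalanConst ^ 2 by ring] at h3
  refine h3.congr_fun fun k => ?_
  have : ((-1 : ℝ) ^ k) * (-1) ^ k = 1 := by rw [← mul_pow]; simp
  simp only [dirichletLogCoeff, add_div, Finset.sum_add_distrib]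
  linear_combination (1 / (2 * (k : ℝ) + 1) ^ 3) *
    (log 2 - ∑ j ∈ Finset.range k, (-1 : ℝ) ^ j / ((j : ℝ) + 1)) * this

/-! ### Dirichlet-kernel integrals of the logarithmic kernel -/

lemma sin_two_mul_nat_factor (j : ℕ) : ∃ A B : ℝ → ℝ, Continuous A ∧ Continuous B ∧
    (∀ p, sin (2 * j * p) = sin p * A p) ∧ ∀ p, sin (2 * j * p) = cos p * B p := by
  induction j with
  | zero => exact ⟨0, 0, continuous_zero, continuous_zero, by simp, by simp⟩
  | succ j ih =>
    obtain ⟨A, B, hA, hB, h1, h2⟩ := ih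
    have h (p : ℝ) : sin (2 * (j + 1 : ℕ) * p) =
        sin (2 * j * p) * cos (2 * p) + cos (2 * j * p) * (2 * sin p * cos p) := by
      rw [← sin_two_mul, ← sin_add]
      push_cast
      ring_nf
    refine ⟨fun p => A p * cos (2 * p) + cos (2 * j * p) * (2 * cos p),
      fun p => B p * cos (2 * p) + cos (2 * j * p) * (2 * sin p), by fun_prop, by fun_prop,
      fun p => ?_, fun p => ?_⟩
    · rw [h, h1]; ring
    · rw [h, h2]; ring

lemma sin_pos_and_cos_pos_of_mem_Ioo {p : ℝ} (hp : p ∈ Ioo 0 (π / 2)) : 0 < sin p ∧ 0 < cos p :=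
  ⟨sin_pos_of_pos_of_lt_pi hp.1 (by linarith [hp.2, pi_pos]),
    cos_pos_of_mem_Ioo ⟨by linarith [hp.1, pi_pos], hp.2⟩⟩

lemma integral_congr_Ioo_half {f g : ℝ → ℝ} (h : ∀ t ∈ Ioo 0 (π / 2), f t = g t) :
    ∫ t in 0..π / 2, f t = ∫ t in 0..π / 2, g t := by
  rw [integral_of_le (by positivity), integral_of_le (by positivity), integral_Ioc_eq_integral_Ioo,
    integral_Ioc_eq_integral_Ioo]
  exact setIntegral_congr_fun measurableSet_Ioo h

lemma IntervalIntegrable.congr_Ioo_half {f g : ℝ → ℝ} (hf : IntervalIntegrable f volume 0 (π / 2))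
    (h : ∀ t ∈ Ioo 0 (π / 2), f t = g t) : IntervalIntegrable g volume 0 (π / 2) :=
  hf.congr_uIoo fun t ht => h t (by rwa [uIoo_of_le (by positivity)] at ht)

lemma integral_cos_two_mul_nat {j : ℕ} (hj : j ≠ 0) : ∫ p in 0..π / 2, cos (2 * j * p) = 0 := by
  have : (2 * (j : ℝ)) ≠ 0 := by positivity
  rw [intervalIntegral.integral_comp_mul_left (f := cos) this, integral_cos,
    show 2 * (j : ℝ) * (π / 2) = j * π by ring, sin_nat_mul_pi]
  simp

lemma integral_sin_div_sin_mul_cos (j : ℕ) :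
    IntervalIntegrable (fun p => sin (2 * j * p) / (sin p * cos p)) volume 0 (π / 2) ∧
    ∫ p in 0..π / 2, sin (2 * j * p) / (sin p * cos p) = π / 2 * (1 - (-1) ^ j) := by
  induction j using Nat.twoStepInduction with
  | zero => simp
  | one =>
    have h : ∀ p ∈ Ioo 0 (π / 2), 2 = sin (2 * (1 : ℕ) * p) / (sin p * cos p) := fun p hp => by
      obtain ⟨h1, h2⟩ := sin_pos_and_cos_pos_of_mem_Ioo hp
      rw [Nat.cast_one, mul_one, sin_two_mul]
      field_simp
    refine ⟨IntervalIntegrable.congr_Ioo_half intervalIntegrable_const h, ?_⟩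
    rw [← integral_congr_Ioo_half h, intervalIntegral.integral_const]
    norm_num
  | more j ih _ =>
    have hc : IntervalIntegrable (fun p => 4 * cos (2 * (j + 1 : ℕ) * p)) volume 0 (π / 2) :=
      Continuous.intervalIntegrable (by fun_prop) _ _
    have h : ∀ p ∈ Ioo 0 (π / 2),
        sin (2 * j * p) / (sin p * cos p) + 4 * cos (2 * (j + 1 : ℕ) * p) =
        sin (2 * (j + 2 : ℕ) * p) / (sin p * cos p) := fun p hp => by
      obtain ⟨h1, h2⟩ := sin_pos_and_cos_pos_of_mem_Ioo hp
      have : sin (2 * (j + 2 : ℕ) * p) - sin (2 * j * p) =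
          2 * (2 * sin p * cos p) * cos (2 * (j + 1 : ℕ) * p) := by
        rw [sin_sub_sin, ← sin_two_mul]
        push_cast
        ring_nf
      rw [eq_add_of_sub_eq this]
      field_simp
      ring
    refine ⟨IntervalIntegrable.congr_Ioo_half (ih.1.add hc) h, ?_⟩
    rw [← integral_congr_Ioo_half h, intervalIntegral.integral_add ih.1 hc, ih.2,
      intervalIntegral.integral_const_mul, integral_cos_two_mul_nat (Nat.succ_ne_zero j), pow_add]
    norm_num

lemma integral_cos_two_mul_nat_mul_logTanHalf {j : ℕ} (hj : j ≠ 0) :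
    ∫ p in 0..π / 2, cos (2 * j * p) * logTanHalf p = -(π / 4) * (1 - (-1) ^ j) / j := by
  have hj' : (j : ℝ) ≠ 0 := by positivity
  have h2 : (0 : ℝ) ≤ π / 2 := by positivity
  obtain ⟨A, B, hA, hB, hsA, hsB⟩ := sin_two_mul_nat_factor j
  set F : ℝ → ℝ := fun p => A p * (sin p * log (sin p)) - B p * (cos p * log (cos p))
    - sin (2 * j * p) * log 2 with hF
  have hcont : ContinuousOn F (Icc 0 (π / 2)) := by
    have h1 : Continuous fun p => sin p * log (sin p) := continuous_mul_log.comp continuous_sin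
    have h2 : Continuous fun p => cos p * log (cos p) := continuous_mul_log.comp continuous_cos
    have : Continuous F := by fun_prop
    exact this.continuousOn
  have hFs (p : ℝ) : F p = sin (2 * j * p) * logTanHalf p := by
    simp only [hF, logTanHalf]
    linear_combination (-log (sin p)) * hsA p + log (cos p) * hsB p
  have hd : ∀ p ∈ Ioo 0 (π / 2), HasDerivAt F (2 * j * (cos (2 * j * p) * logTanHalf p) +
      sin (2 * j * p) / (sin p * cos p)) p := fun p hp => by
    obtain ⟨h1, h2⟩ := sin_pos_and_cos_pos_of_mem_Ioo hp
    have d1 := (((hasDerivAt_id p).const_mul (2 * (j : ℝ))).sin).mul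
      (((hasDerivAt_log_sin h1.ne').sub (hasDerivAt_log_cos h2.ne')).sub_const (log 2))
    refine (d1.congr_of_eventuallyEq (Eventually.of_forall fun q => hFs q)).congr_deriv ?_
    simp only [id, logTanHalf, Pi.sub_apply]
    have : cos p / sin p - -(sin p / cos p) = 1 / (sin p * cos p) := by
      field_simp
      linarith [sin_sq_add_cos_sq p]
    rw [this]
    ring
  have hi : IntervalIntegrable (fun p => 2 * j * (cos (2 * j * p) * logTanHalf p))
      volume 0 (π / 2) :=
    ((intervalIntegrable_logTanHalf _ _).continuousOn_mul (by fun_prop)).const_mul _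
  obtain ⟨hi2, hv⟩ := integral_sin_div_sin_mul_cos j
  have := integral_eq_sub_of_hasDerivAt_of_le h2 hcont hd (hi.add hi2)
  rw [intervalIntegral.integral_add hi hi2, intervalIntegral.integral_const_mul, hv, hFs, hFs,
    show 2 * (j : ℝ) * (π / 2) = j * π by ring, sin_nat_mul_pi, mul_zero, sin_zero] at this
  rw [eq_div_iff hj']
  linarith

lemma integral_logTanHalf : ∫ p in 0..π / 2, logTanHalf p = -(π / 2) * log 2 := by
  have hs := intervalIntegrable_log_sin (a := 0) (b := π / 2)
  have hc := intervalIntegrable_log_cos (a := 0) (b := π / 2)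
  have h1 : ∫ p in 0..π / 2, log (cos p) = ∫ p in 0..π / 2, log (sin p) := by
    have := intervalIntegral.integral_comp_sub_left (a := 0) (b := π / 2)
      (fun p => log (sin p)) (π / 2)
    simpa only [sin_pi_div_two_sub, sub_zero, sub_self] using this
  have h2 := intervalIntegral.integral_sub (hs.sub hc) (intervalIntegrable_const (c := log 2))
  rw [intervalIntegral.integral_sub hs hc] at h2
  simp only [Function.comp] at h2
  simp only [logTanHalf]
  rw [h2, h1, intervalIntegral.integral_const, smul_eq_mul]
  ring

lemma abs_sin_odd_mul_div_sin_le {p : ℝ} (hp : 0 < sin p) (k : ℕ) :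
    |sin ((2 * k + 1) * p) / sin p| ≤ 2 * k + 1 := by
  induction k with
  | zero => simp [hp.ne']
  | succ k ih =>
    have h : sin ((2 * (k + 1 : ℕ) + 1) * p) / sin p =
        sin ((2 * k + 1) * p) / sin p + 2 * cos (2 * (k + 1 : ℕ) * p) := by
      have : sin ((2 * (k + 1 : ℕ) + 1) * p) - sin ((2 * k + 1) * p) =
          2 * sin p * cos (2 * (k + 1 : ℕ) * p) := by
        rw [sin_sub_sin]
        push_cast
        ring_nf
      rw [eq_add_of_sub_eq this]
      field_simp
      ring
    rw [h]
    have h1 : |2 * cos (2 * (k + 1 : ℕ) * p)| ≤ 2 := by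
      rw [abs_mul, abs_two]
      linarith [abs_cos_le_one (2 * (k + 1 : ℕ) * p)]
    refine (abs_add_le _ _).trans ?_
    push_cast at *
    linarith

lemma integral_sin_odd_mul_div_sin_mul_logTanHalf (k : ℕ) :
    IntervalIntegrable (fun p => sin ((2 * k + 1) * p) / sin p * logTanHalf p) volume 0 (π / 2) ∧
    ∫ p in 0..π / 2, sin ((2 * k + 1) * p) / sin p * logTanHalf p =
      -(π / 2) * dirichletLogCoeff k := by
  induction k with
  | zero =>
    have h : ∀ p ∈ Ioo 0 (π / 2), logTanHalf p =
        sin ((2 * (0 : ℕ) + 1) * p) / sin p * logTanHalf p := fun p hp => by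
      have := (sin_pos_and_cos_pos_of_mem_Ioo hp).1.ne'
      simp [this]
    refine ⟨(intervalIntegrable_logTanHalf _ _).congr_Ioo_half h, ?_⟩
    rw [← integral_congr_Ioo_half h, integral_logTanHalf]
    simp [dirichletLogCoeff]
  | succ k ih =>
    have hi : IntervalIntegrable (fun p => 2 * (cos (2 * (k + 1 : ℕ) * p) * logTanHalf p))
        volume 0 (π / 2) :=
      ((intervalIntegrable_logTanHalf _ _).continuousOn_mul (by fun_prop)).const_mul _
    have h : ∀ p ∈ Ioo 0 (π / 2), sin ((2 * k + 1) * p) / sin p * logTanHalf p +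
        2 * (cos (2 * (k + 1 : ℕ) * p) * logTanHalf p) =
        sin ((2 * (k + 1 : ℕ) + 1) * p) / sin p * logTanHalf p := fun p hp => by
      have h0 := (sin_pos_and_cos_pos_of_mem_Ioo hp).1.ne'
      have : sin ((2 * (k + 1 : ℕ) + 1) * p) - sin ((2 * k + 1) * p) =
          2 * sin p * cos (2 * (k + 1 : ℕ) * p) := by
        rw [sin_sub_sin]
        push_cast
        ring_nf
      rw [eq_add_of_sub_eq this]
      field_simp
      ring
    refine ⟨(ih.1.add hi).congr_Ioo_half h, ?_⟩
    rw [← integral_congr_Ioo_half h, intervalIntegral.integral_add ih.1 hi, ih.2,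
      intervalIntegral.integral_const_mul,
      integral_cos_two_mul_nat_mul_logTanHalf (Nat.succ_ne_zero k)]
    simp only [dirichletLogCoeff, Finset.sum_range_succ, Nat.succ_eq_add_one, pow_succ]
    push_cast
    have : (k : ℝ) + 1 ≠ 0 := by positivity
    field_simp
    ring

/-! ### The parabolic moment -/

lemma hasSum_sin_odd_div_cube {p : ℝ} (hp : p ∈ Icc 0 (π / 2)) :
    HasSum (fun k : ℕ => 1 / (2 * (k : ℝ) + 1) ^ 3 * sin ((2 * k + 1) * p))
      (π / 8 * (p * (π - p))) := by
  have hπ := pi_pos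
  have hb (x : ℝ) : (Polynomial.map (algebraMap ℚ ℝ) (Polynomial.bernoulli 3)).eval x =
      x ^ 3 - 3 / 2 * x ^ 2 + 1 / 2 * x := by
    rw [Polynomial.eval_map_algebraMap]
    simp_rw [Polynomial.bernoulli, Finset.sum_range_succ, map_add, Polynomial.aeval_monomial]
    simp [_root_.bernoulli_one, Nat.choose, bernoulli_eq_bernoulli'_of_ne_one]
    ring
  have hS (x : ℝ) (hx : x ∈ Icc 0 π) : HasSum (fun n : ℕ => 1 / (n : ℝ) ^ 3 * sin (n * x))
      (2 * π ^ 3 / 3 *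
        ((x / (2 * π)) ^ 3 - 3 / 2 * (x / (2 * π)) ^ 2 + 1 / 2 * (x / (2 * π)))) := by
    have := hasSum_one_div_nat_pow_mul_sin one_ne_zero (x := x / (2 * π))
      ⟨by have := hx.1; positivity, by rw [div_le_one (by positivity)]; linarith [hx.2]⟩
    rw [show 2 * 1 + 1 = 3 from rfl, hb] at this
    convert! this using 1
    · funext n
      congr 2
      field_simp
    · have h6 : ((Nat.factorial 3 : ℕ) : ℝ) = 6 := by norm_num [Nat.factorial]
      rw [h6]
      ring
  have h1 := hS p ⟨hp.1, by linarith [hp.2]⟩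
  have h2 := (hS (2 * p) ⟨by linarith [hp.1], by linarith [hp.2]⟩).mul_left (1 / 8)
  have h3 : HasSum (fun k : ℕ => 1 / ((2 * k : ℕ) : ℝ) ^ 3 * sin ((2 * k : ℕ) * p)) _ :=
    h2.congr_fun fun k => by
      push_cast
      rw [mul_pow, one_div_mul_eq_div]
      ring_nf
  have h4 : Summable fun k : ℕ => 1 / (2 * (k : ℝ) + 1) ^ 3 * sin ((2 * k + 1) * p) := by
    have := h1.summable.comp_injective injective_two_mul_add_one
    refine this.congr fun k => ?_
    simp
  have h5 := h3.even_add_odd (f := fun n : ℕ => 1 / (n : ℝ) ^ 3 * sin (n * p))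
    (by push_cast; exact h4.hasSum)
  have h6 := h5.unique h1
  convert h4.hasSum using 1
  rw [← sub_eq_iff_eq_add'.2 h6.symm]
  field_simp
  ring

lemma integral_mul_pi_sub_div_sin_mul_logTanHalf :
    ∫ p in 0..π / 2, p * (π - p) / sin p * logTanHalf p = -4 * catalanConst ^ 2 := by
  set μ : Measure ℝ := volume.restrict (Ioo 0 (π / 2)) with hμ
  have h2 : (0 : ℝ) ≤ π / 2 := by positivity
  have key : ∀ g : ℝ → ℝ, ∫ x in 0..π / 2, g x = ∫ x, g x ∂μ := fun g => by
    rw [integral_of_le h2, integral_Ioc_eq_integral_Ioo]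
  set F : ℕ → ℝ → ℝ := fun k p => 1 / (2 * (k : ℝ) + 1) ^ 3 *
    (sin ((2 * k + 1) * p) / sin p * logTanHalf p) with hF
  have hFi (k : ℕ) : Integrable (F k) μ :=
    ((intervalIntegrable_iff_integrableOn_Ioo_of_le h2).1
      (integral_sin_odd_mul_div_sin_mul_logTanHalf k).1).const_mul _
  have hκ : Integrable logTanHalf μ :=
    (intervalIntegrable_iff_integrableOn_Ioo_of_le h2).1 (intervalIntegrable_logTanHalf _ _)
  have hs : Summable fun k => ∫ p, ‖F k p‖ ∂μ := by
    refine Summable.of_nonneg_of_le (fun k => integral_nonneg fun p => norm_nonneg _) (fun k => ?_)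
      ((summable_one_div_odd_pow one_lt_two).mul_right (∫ p, ‖logTanHalf p‖ ∂μ))
    rw [← MeasureTheory.integral_const_mul]
    refine setIntegral_mono_on (hFi k).norm (hκ.norm.const_mul _) measurableSet_Ioo fun p hp => ?_
    have h1 := abs_sin_odd_mul_div_sin_le (sin_pos_and_cos_pos_of_mem_Ioo hp).1 k
    have hk : (0 : ℝ) < 2 * k + 1 := by positivity
    simp only [hF, norm_mul, Real.norm_eq_abs (_ / sin p)]
    rw [Real.norm_of_nonneg (by positivity), ← mul_assoc]
    refine mul_le_mul_of_nonneg_right ?_ (norm_nonneg _)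
    calc 1 / (2 * (k : ℝ) + 1) ^ 3 * |sin ((2 * k + 1) * p) / sin p|
        ≤ 1 / (2 * (k : ℝ) + 1) ^ 3 * (2 * k + 1) := by gcongr
      _ = 1 / (2 * (k : ℝ) + 1) ^ 2 := by field_simp
  have h1 := hasSum_integral_of_summable_integral_norm hFi hs
  have h3 : ∫ p, ∑' k, F k p ∂μ = π / 8 * ∫ p in 0..π / 2, p * (π - p) / sin p * logTanHalf p := by
    rw [← intervalIntegral.integral_const_mul, key]
    refine setIntegral_congr_fun measurableSet_Ioo fun p hp => ?_
    have := ((hasSum_sin_odd_div_cube (Ioo_subset_Icc_self hp)).div_const (sin p)).mul_right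
      (logTanHalf p)
    simp only [hF]
    rw [(this.congr_fun fun k => by ring).tsum_eq]
    ring
  have h4 (k : ℕ) :
      ∫ p, F k p ∂μ = -(π / 2) * (1 / (2 * (k : ℝ) + 1) ^ 3 * dirichletLogCoeff k) := by
    rw [← key, intervalIntegral.integral_const_mul,
      (integral_sin_odd_mul_div_sin_mul_logTanHalf k).2]
    ring
  simp only [h4, h3] at h1
  have h5 := h1.unique (hasSum_dirichletLogCoeff.mul_left (-(π / 2)))
  refine mul_left_cancel₀ (show π / 8 ≠ 0 by positivity) ?_
  rw [h5]
  ring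

/-! ### Odd sine moments of the logarithmic kernel -/

/-- The coefficients `4ⁿ / binom(2n, n)` of the expansion of `arcsin²`. -/
noncomputable def wallisCoeff (n : ℕ) : ℝ := 4 ^ n / n.centralBinom

lemma wallisCoeff_pos (n : ℕ) : 0 < wallisCoeff n := by
  have := n.centralBinom_pos
  unfold wallisCoeff
  positivity

lemma wallisCoeff_succ (n : ℕ) :
    wallisCoeff (n + 1) = wallisCoeff n * ((2 * n + 2) / (2 * n + 1)) := by
  have h := congrArg (Nat.cast (R := ℝ)) (Nat.succ_mul_centralBinom_succ n)
  push_cast at h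
  have h1 : (0 : ℝ) < n.centralBinom := by exact_mod_cast n.centralBinom_pos
  have h2 : (0 : ℝ) < (n + 1).centralBinom := by exact_mod_cast (n + 1).centralBinom_pos
  unfold wallisCoeff
  rw [div_mul_div_comm, div_eq_div_iff (by positivity) (by positivity), pow_succ]
  linear_combination (-2 * 4 ^ n : ℝ) * h

lemma integral_sin_pow_odd_half (n : ℕ) :
    ∫ p in 0..π / 2, sin p ^ (2 * n + 1) = wallisCoeff n / (2 * n + 1) := by
  induction n with
  | zero => simp [wallisCoeff]
  | succ n ih =>
    rw [show 2 * (n + 1) + 1 = 2 * n + 1 + 2 by ring, integral_sin_pow, ih, wallisCoeff_succ]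
    simp only [sin_zero, cos_pi_div_two]
    push_cast
    field_simp
    simp
    ring

lemma integral_sin_mul_logTanHalf : ∫ p in 0..π / 2, sin p * logTanHalf p = 0 := by
  have h2 : (0 : ℝ) ≤ π / 2 := by positivity
  have hc1 {p : ℝ} (hp : p ∈ Icc 0 (π / 2)) : 0 < 1 + cos p := by
    linarith [cos_nonneg_of_mem_Icc ⟨by linarith [hp.1, pi_pos], hp.2⟩]
  set F : ℝ → ℝ := fun p =>
    (1 - cos p) * log (sin p) + cos p * log (cos p) - log (1 + cos p) + cos p * log 2 with hF
  have hcont : ContinuousOn F (Icc 0 (π / 2)) := by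
    have h1 : Continuous fun p => sin p * log (sin p) := continuous_mul_log.comp continuous_sin
    have h2 : Continuous fun p => cos p * log (cos p) := continuous_mul_log.comp continuous_cos
    have h3 : ContinuousOn (fun p => sin p / (1 + cos p) * (sin p * log (sin p)) +
        cos p * log (cos p) - log (1 + cos p) + cos p * log 2) (Icc 0 (π / 2)) := by
      refine ((((ContinuousOn.div (by fun_prop) (by fun_prop) fun p hp => (hc1 hp).ne').mul
        h1.continuousOn).add h2.continuousOn).sub (ContinuousOn.log (by fun_prop)
          fun p hp => (hc1 hp).ne')).add (by fun_prop)
    refine h3.congr fun p hp => ?_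
    have := (hc1 hp).ne'
    simp only [hF]
    congr 3
    field_simp
    rw [sin_sq]
    ring
  have hd : ∀ p ∈ Ioo 0 (π / 2), HasDerivAt F (sin p * logTanHalf p) p := fun p hp => by
    obtain ⟨h1, h2⟩ := sin_pos_and_cos_pos_of_mem_Ioo hp
    have h3 := (hc1 (Ioo_subset_Icc_self hp)).ne'
    have d := ((((hasDerivAt_cos p).const_sub 1).mul (hasDerivAt_log_sin h1.ne')).add
      ((hasDerivAt_cos p).mul (hasDerivAt_log_cos h2.ne'))).sub
      (((hasDerivAt_cos p).const_add 1).log h3)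
    refine (d.add ((hasDerivAt_cos p).mul_const (log 2))).congr_deriv ?_
    simp only [logTanHalf]
    have e : (1 - cos p) * (cos p / sin p) = sin p * cos p / (1 + cos p) := by
      field_simp
      rw [sin_sq]
      ring
    rw [neg_neg, e]
    field_simp
    ring
  rw [integral_eq_sub_of_hasDerivAt_of_le h2 hcont hd
    ((intervalIntegrable_logTanHalf _ _).continuousOn_mul (by fun_prop))]
  simp [hF, one_add_one_eq_two]

lemma integral_sin_pow_odd_mul_logTanHalf (n : ℕ) :
    ∫ p in 0..π / 2, sin p ^ (2 * n + 1) * logTanHalf p =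
      (∑ k ∈ Finset.Icc 1 n, (1 : ℝ) / k) / 2 * (wallisCoeff n / (2 * n + 1)) := by
  induction n with
  | zero => simp [integral_sin_mul_logTanHalf]
  | succ n ih =>
    have h2 : (0 : ℝ) ≤ π / 2 := by positivity
    set F : ℝ → ℝ := fun p => -cos p * sin p ^ (2 * n + 1) * (sin p * log (sin p)) +
      sin p ^ (2 * n + 2) * (cos p * log (cos p)) + cos p * sin p ^ (2 * n + 2) * log 2 with hF
    have hFe (p : ℝ) : F p = -cos p * sin p ^ (2 * n + 2) * logTanHalf p := by
      simp only [hF, logTanHalf]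
      ring
    have hcont : Continuous F := by
      have h1 : Continuous fun p => sin p * log (sin p) := continuous_mul_log.comp continuous_sin
      have h2 : Continuous fun p => cos p * log (cos p) := continuous_mul_log.comp continuous_cos
      fun_prop
    have hi (m : ℕ) : IntervalIntegrable (fun p => sin p ^ m * logTanHalf p) volume 0 (π / 2) :=
      (intervalIntegrable_logTanHalf _ _).continuousOn_mul (by fun_prop)
    have hi1 := (hi (2 * (n + 1) + 1)).const_mul (2 * n + 3)
    have hi2 := (hi (2 * n + 1)).const_mul (2 * n + 2)
    have hi3 : IntervalIntegrable (fun p => sin p ^ (2 * n + 1)) volume 0 (π / 2) :=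
      Continuous.intervalIntegrable (by fun_prop) _ _
    have hd : ∀ p ∈ Ioo 0 (π / 2), HasDerivAt F ((2 * n + 3) *
        (sin p ^ (2 * (n + 1) + 1) * logTanHalf p) - (2 * n + 2) *
        (sin p ^ (2 * n + 1) * logTanHalf p) - sin p ^ (2 * n + 1)) p := fun p hp => by
      obtain ⟨h1, h2⟩ := sin_pos_and_cos_pos_of_mem_Ioo hp
      have d := ((hasDerivAt_cos p).neg.mul ((hasDerivAt_sin p).pow (2 * n + 2))).mul
        (((hasDerivAt_log_sin h1.ne').sub (hasDerivAt_log_cos h2.ne')).sub_const (log 2))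
      refine (d.congr_of_eventuallyEq (Eventually.of_forall fun q => hFe q)).congr_deriv ?_
      have e : cos p / sin p - -(sin p / cos p) = 1 / (sin p * cos p) := by
        field_simp
        linarith [sin_sq_add_cos_sq p]
      have e2 : -cos p * sin p ^ (2 * n + 2) * (1 / (sin p * cos p)) = -sin p ^ (2 * n + 1) := by
        field_simp
        ring
      simp only [Pi.mul_apply, Pi.neg_apply, Pi.pow_apply, Pi.sub_apply, e, e2]
      change _ * logTanHalf p + _ = _
      push_cast
      linear_combination ((-2 * (n : ℝ) - 2) * sin p ^ (2 * n + 1) * logTanHalf p) *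
        sin_sq_add_cos_sq p
    have := integral_eq_sub_of_hasDerivAt_of_le h2 hcont.continuousOn hd ((hi1.sub hi2).sub hi3)
    rw [intervalIntegral.integral_sub (hi1.sub hi2) hi3, intervalIntegral.integral_sub hi1 hi2,
      intervalIntegral.integral_const_mul, intervalIntegral.integral_const_mul, ih,
      integral_sin_pow_odd_half, hFe, hFe] at this
    simp only [cos_pi_div_two, sin_zero, neg_zero, zero_mul, ne_eq, Nat.add_eq_zero_iff,
      OfNat.ofNat_ne_zero, and_false, not_false_eq_true, zero_pow, mul_zero, sub_zero] at this
    rw [Finset.sum_Icc_succ_top (by omega), wallisCoeff_succ]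
    refine mul_left_cancel₀ (show 2 * (n : ℝ) + 3 ≠ 0 by positivity) ?_
    rw [eq_add_of_sub_eq (eq_add_of_sub_eq this)]
    push_cast
    field_simp
    ring

/-! ### The expansion of `arcsin²` -/

lemma nonneg_of_hasDerivAt_nonneg {f f' : ℝ → ℝ} (hf : ∀ x, HasDerivAt f (f' x) x) (h0 : f 0 = 0)
    {b : ℝ} (h : ∀ x ∈ Icc 0 b, 0 ≤ f' x) {t : ℝ} (ht : t ∈ Icc 0 b) : 0 ≤ f t := by
  have hm : MonotoneOn f (Icc 0 b) := by
    refine monotoneOn_of_deriv_nonneg (convex_Icc 0 b)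
      (fun x _ => (hf x).continuousAt.continuousWithinAt)
      (fun x _ => (hf x).differentiableAt.differentiableWithinAt) fun x hx => ?_
    rw [(hf x).deriv]
    exact h x (interior_subset hx)
  exact h0 ▸ hm ⟨le_rfl, ht.1.trans ht.2⟩ ht ht.1

/-- The terms of the expansion of `p²` in powers of `sin p`. -/
noncomputable def arcsinSqTerm (j : ℕ) (p : ℝ) : ℝ :=
  wallisCoeff (j + 1) / (2 * (j + 1) ^ 2) * sin p ^ (2 * j + 2)

lemma hasDerivAt_arcsin_remainder (n : ℕ) (p : ℝ) :
    HasDerivAt (fun p => p - cos p * ∑ j ∈ Finset.range n,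
      wallisCoeff (j + 1) / (2 * (j + 1)) * sin p ^ (2 * j + 1))
      (wallisCoeff n * sin p ^ (2 * n)) p := by
  induction n with
  | zero => simpa [wallisCoeff] using hasDerivAt_id' p
  | succ n ih =>
    have d := ih.sub (((hasDerivAt_cos p).mul ((hasDerivAt_sin p).pow (2 * n + 1))).const_mul
      (wallisCoeff (n + 1) / (2 * (n + 1))))
    refine (d.congr_of_eventuallyEq (Eventually.of_forall fun q => ?_)).congr_deriv ?_
    · simp only [Finset.sum_range_succ, Pi.sub_apply, Pi.mul_apply, Pi.pow_apply]
      ring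
    · have h : wallisCoeff n = wallisCoeff (n + 1) / (2 * (n + 1)) * (2 * n + 1) := by
        rw [wallisCoeff_succ]
        field_simp
      have h' : wallisCoeff (n + 1) = wallisCoeff (n + 1) / (2 * (n + 1)) * (2 * (n + 1)) := by
        field_simp
      rw [h, h', show 2 * n + 1 - 1 = 2 * n by omega]
      set c := wallisCoeff (n + 1) / (2 * (n + 1))
      have : c * (2 * (n + 1)) / (2 * (n + 1)) = c := by field_simp
      simp only [this, Pi.pow_apply]
      push_cast
      linear_combination (-c * (2 * n + 1) * sin p ^ (2 * n)) * sin_sq_add_cos_sq p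

lemma hasDerivAt_arcsinSq_remainder (n : ℕ) (p : ℝ) :
    HasDerivAt (fun p => p ^ 2 - ∑ j ∈ Finset.range n, arcsinSqTerm j p)
      (2 * (p - cos p * ∑ j ∈ Finset.range n,
        wallisCoeff (j + 1) / (2 * (j + 1)) * sin p ^ (2 * j + 1))) p := by
  have d : ∀ j ∈ Finset.range n, HasDerivAt (arcsinSqTerm j)
      (2 * cos p * (wallisCoeff (j + 1) / (2 * (j + 1)) * sin p ^ (2 * j + 1))) p := fun j _ => by
    refine (((hasDerivAt_sin p).pow (2 * j + 2)).const_mul _).congr_deriv ?_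
    rw [show 2 * j + 2 - 1 = 2 * j + 1 by omega]
    push_cast
    field_simp
  refine ((hasDerivAt_pow 2 p).sub (HasDerivAt.fun_sum d)).congr_deriv ?_
  rw [← Finset.mul_sum]
  push_cast
  ring

lemma arcsinSqTerm_nonneg (j : ℕ) {p : ℝ} (hp : 0 ≤ sin p) : 0 ≤ arcsinSqTerm j p := by
  have := wallisCoeff_pos (j + 1)
  unfold arcsinSqTerm
  positivity

lemma arcsinSq_remainder_bounds (n : ℕ) {p : ℝ} (hp : p ∈ Icc 0 (π / 2)) :
    0 ≤ p ^ 2 - ∑ j ∈ Finset.range n, arcsinSqTerm j p ∧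
    p ^ 2 - ∑ j ∈ Finset.range n, arcsinSqTerm j p ≤ wallisCoeff n * sin p ^ (2 * n) * p ^ 2 := by
  have hw := wallisCoeff_pos n
  have hmono {x : ℝ} (hx : x ∈ Icc 0 p) : sin x ^ (2 * n) ≤ sin p ^ (2 * n) := by
    have h0 : 0 ≤ sin x := sin_nonneg_of_nonneg_of_le_pi hx.1 (by linarith [hx.2, hp.2, pi_pos])
    have := sin_le_sin_of_le_of_le_pi_div_two (by linarith [hx.1, pi_pos]) hp.2 hx.2
    gcongr
  have hpp : p ∈ Icc 0 p := ⟨hp.1, le_rfl⟩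
  have h0 : (fun p => p ^ 2 - ∑ j ∈ Finset.range n, arcsinSqTerm j p) 0 = 0 := by
    simp [arcsinSqTerm]
  constructor
  · refine nonneg_of_hasDerivAt_nonneg (hasDerivAt_arcsinSq_remainder n) h0 (fun x hx => ?_) hpp
    refine mul_nonneg two_pos.le (nonneg_of_hasDerivAt_nonneg (hasDerivAt_arcsin_remainder n)
      (by simp) (fun y hy => ?_) hx)
    rw [pow_mul]
    positivity
  · set K := wallisCoeff n * sin p ^ (2 * n)
    refine sub_nonneg.1 (nonneg_of_hasDerivAt_nonneg (fun x => ((hasDerivAt_pow 2 x).const_mul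
      K).sub (hasDerivAt_arcsinSq_remainder n x)) (by simp [arcsinSqTerm]) (fun x hx => ?_) hpp)
    have := nonneg_of_hasDerivAt_nonneg (fun x => ((hasDerivAt_id x).const_mul K).sub
      (hasDerivAt_arcsin_remainder n x)) (by simp) (b := p) (fun y hy => ?_) hx
    · simp only [Pi.sub_apply, id] at this
      push_cast
      linarith
    · have := mul_le_mul_of_nonneg_left (hmono hy) hw.le
      linarith

lemma hasSum_arcsinSqTerm {p : ℝ} (hp : p ∈ Ioo 0 (π / 2)) :
    HasSum (fun j => arcsinSqTerm j p) (p ^ 2) := by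
  obtain ⟨hs, hc⟩ := sin_pos_and_cos_pos_of_mem_Ioo hp
  rw [hasSum_iff_tendsto_nat_of_nonneg fun j => arcsinSqTerm_nonneg j hs.le]
  have hs1 : sin p ^ 2 < 1 := by linarith [sin_sq_add_cos_sq p, pow_pos hc 2]
  have hlim : Tendsto (fun n : ℕ => (2 * (n * (sin p ^ 2) ^ n)) * p ^ 2) atTop (𝓝 0) := by
    simpa using ((tendsto_self_mul_const_pow_of_lt_one (sq_nonneg _) hs1).const_mul 2).mul_const
      (p ^ 2)
  have hr : Tendsto (fun n : ℕ => p ^ 2 - ∑ j ∈ Finset.range n, arcsinSqTerm j p) atTop (𝓝 0) := by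
    refine tendsto_of_tendsto_of_tendsto_of_le_of_le' tendsto_const_nhds hlim
      (Eventually.of_forall fun n => (arcsinSq_remainder_bounds n (Ioo_subset_Icc_self hp)).1) ?_
    filter_upwards [eventually_ge_atTop 1] with n hn
    refine (arcsinSq_remainder_bounds n (Ioo_subset_Icc_self hp)).2.trans ?_
    have hw : wallisCoeff n ≤ 2 * n := by
      have h1 : (0 : ℝ) < n.centralBinom := by exact_mod_cast n.centralBinom_pos
      rw [wallisCoeff, div_le_iff₀ h1]
      exact_mod_cast Nat.four_pow_le_two_mul_self_mul_centralBinom n hn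
    rw [pow_mul, ← mul_assoc 2]
    gcongr
  have h := hr.const_sub (p ^ 2)
  rw [sub_zero] at h
  exact h.congr fun n => by ring

/-! ### The inverse binomial series -/

lemma hasSum_harmonic_mul_wallisCoeff_sq :
    HasSum (fun j : ℕ =>
        (∑ k ∈ Finset.Icc 1 j, (1 : ℝ) / k) / (j + 1) ^ 3 * wallisCoeff (j + 1) ^ 2)
      (8 * ∫ p in 0..π / 2, p ^ 2 / sin p * logTanHalf p) := by
  set μ : Measure ℝ := volume.restrict (Ioo 0 (π / 2)) with hμ
  have h2 : (0 : ℝ) ≤ π / 2 := by positivity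
  have key : ∀ g : ℝ → ℝ, ∫ x in 0..π / 2, g x = ∫ x, g x ∂μ := fun g => by
    rw [integral_of_le h2, integral_Ioc_eq_integral_Ioo]
  have hae {P : ℝ → Prop} (h : ∀ p ∈ Ioo 0 (π / 2), P p) : ∀ᵐ p ∂μ, P p :=
    (ae_restrict_iff' measurableSet_Ioo).2 (Eventually.of_forall h)
  have hκ := intervalIntegrable_logTanHalf 0 (π / 2)
  set F : ℕ → ℝ → ℝ := fun j p =>
    wallisCoeff (j + 1) / (2 * (j + 1) ^ 2) * (sin p ^ (2 * j + 1) * logTanHalf p) with hF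
  have hFi (j : ℕ) : Integrable (F j) μ :=
    ((intervalIntegrable_iff_integrableOn_Ioo_of_le h2).1
      (hκ.continuousOn_mul (by fun_prop))).const_mul _
  have hFe (j : ℕ) {p : ℝ} (hp : p ∈ Ioo 0 (π / 2)) :
      F j p = arcsinSqTerm j p / sin p * logTanHalf p := by
    have := (sin_pos_and_cos_pos_of_mem_Ioo hp).1
    simp only [hF, arcsinSqTerm]
    field_simp
    ring
  have hbs {p : ℝ} (hp : p ∈ Ioo 0 (π / 2)) :=
    ((hasSum_arcsinSqTerm hp).div_const (sin p)).mul_right |logTanHalf p|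
  have hmain := hasSum_integral_of_dominated_convergence (μ := μ) (F := F)
    (f := fun p => p ^ 2 / sin p * logTanHalf p)
    (fun j p => arcsinSqTerm j p / sin p * |logTanHalf p|)
    (fun j => (hFi j).aestronglyMeasurable)
    (fun j => hae fun p hp => by
      have hs := (sin_pos_and_cos_pos_of_mem_Ioo hp).1.le
      rw [hFe j hp, norm_mul, Real.norm_of_nonneg (div_nonneg (arcsinSqTerm_nonneg j hs) hs),
        Real.norm_eq_abs])
    (hae fun p hp => (hbs hp).summable)
    (by
      have h := (intervalIntegrable_iff_integrableOn_Ioo_of_le h2).1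
        (IntervalIntegrable.div_sin_mul (hκ.abs.continuousOn_mul (g := fun p => p) (by fun_prop)))
      refine h.congr (hae fun p hp => ?_)
      refine Eq.trans ?_ (hbs hp).tsum_eq.symm
      ring)
    (hae fun p hp => by
      simp only [hFe _ hp]
      exact ((hasSum_arcsinSqTerm hp).div_const (sin p)).mul_right (logTanHalf p))
  rw [key]
  refine (hmain.mul_left 8).congr_fun fun j => ?_
  rw [← key, intervalIntegral.integral_const_mul, integral_sin_pow_odd_mul_logTanHalf,
    wallisCoeff_succ]
  field_simp
  ring

lemma integral_sq_div_sin_mul_logTanHalf :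
    ∫ p in 0..π / 2, p ^ 2 / sin p * logTanHalf p =
      π * (3 * π ^ 3 / 16 - 4 * catalanConst * log 2 + π * log 2 ^ 2 / 4
        - 8 * (cpolylog 3 ((1 + Complex.I) / 2)).im) + 4 * catalanConst ^ 2 := by
  have hκ := intervalIntegrable_logTanHalf 0 (π / 2)
  have h1 := (IntervalIntegrable.div_sin_mul hκ).const_mul π
  have h2 : IntervalIntegrable (fun p => p * (π - p) / sin p * logTanHalf p) volume 0 (π / 2) :=
    (IntervalIntegrable.div_sin_mul (hκ.continuousOn_mul (g := fun p => π - p)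
      (by fun_prop))).congr_Ioo_half fun p _ => by ring
  rw [← integral_div_sin_mul_logTanHalf, ← sub_neg_eq_add, ← neg_mul,
    ← integral_mul_pi_sub_div_sin_mul_logTanHalf, ← intervalIntegral.integral_const_mul,
    ← intervalIntegral.integral_sub h1 h2]
  congr 1
  funext p
  ring

end

/-- `∑_{n=2}^∞ (H_{n−1}/n³)·(4^{−n}·C(2n,n))^{−2}
= 32C² − 32πC·log 2 − 64π·Im(Li₃((1+i)/2)) + 3π⁴/2 + 2π²·log²2`. -/
theorem statement18 :
    (∑' n : ℕ, (∑ k ∈ Finset.Icc 1 (n + 1), (1 : ℝ) / (k : ℝ)) / ((n + 2 : ℕ) : ℝ) ^ 3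
        * 16 ^ (n + 2) / (Nat.choose (2 * (n + 2)) (n + 2) : ℝ) ^ 2)
      = 32 * catalanConst ^ 2 - 32 * Real.pi * catalanConst * Real.log 2
        - 64 * Real.pi * (cpolylog 3 ((1 + Complex.I) / 2)).im
        + 3 * Real.pi ^ 4 / 2 + 2 * Real.pi ^ 2 * Real.log 2 ^ 2 := by
  have h := (hasSum_nat_add_iff' 1).2 hasSum_harmonic_mul_wallisCoeff_sq
  rw [integral_sq_div_sin_mul_logTanHalf] at h
  refine (h.congr_fun fun n => ?_).tsum_eq.trans ?_
  · rw [wallisCoeff, div_pow, ← pow_mul, mul_comm (n + 1 + 1) 2, pow_mul, Nat.centralBinom]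
    norm_num
    ring
  · simp
    ring
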